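/- arXiv:1407.0673 — 3 statements merged into one kernel-verified Lean document; each statement's English description precedes it below -/
import Mathlib

section
/- Let n ≥ 3 and 2−n < γ < 0. There exists a constant C > 0, depending only on n and γ, such that for every function u in the weighted space C²_γ(ℝⁿ₊) one has sup_{x ∈ ℝⁿ₊} ρ(x)^{−γ}|u(x)| ≤ C · sup_{x ∈ ℝⁿ₊} ρ(x)^{−γ+2}|Δu(x)| + C · sup_{x ∈ ∂ℝⁿ₊} ρ(x)^{−γ+1}|∂u/∂xₙ(x)|. -/
open MeasureTheory Metric Filter
open scoped ENNReal Topology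

noncomputable section

/-- The closed half-space `{x : x k ≥ 0}`, where `k` is the distinguished (last) coordinate. -/
def upperHalf (n : ℕ) (k : Fin n) : Set (EuclideanSpace ℝ (Fin n)) := {x | 0 ≤ x k}

/-- The boundary hyperplane `{x : x k = 0}`. -/
def bdryPlane (n : ℕ) (k : Fin n) : Set (EuclideanSpace ℝ (Fin n)) := {x | x k = 0}

/-- Membership in the weighted space `C^k_γ(S)`: `u` is `C^k` on `S` and for each `i ≤ k`
the weighted sup `sup_{x ∈ S} ρ(x)^{-γ+i} ‖Dⁱu(x)‖` is finite, where `ρ(x) = 1 + |x|`. -/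
def MemCgamma (n : ℕ) (k : ℕ) (γ : ℝ) (S : Set (EuclideanSpace ℝ (Fin n)))
    (u : EuclideanSpace ℝ (Fin n) → ℝ) : Prop :=
  ContDiffOn ℝ k u S ∧
    ∀ i, i ≤ k → ∃ M : ℝ, ∀ x ∈ S,
      (1 + ‖x‖) ^ (-γ + (i : ℝ)) * ‖iteratedFDerivWithin ℝ i u S x‖ ≤ M

/-- The Euclidean Laplacian `Δu = Σᵢ ∂²u/∂xᵢ²`, computed with derivatives within `S`. -/
def lapWithin (n : ℕ) (S : Set (EuclideanSpace ℝ (Fin n)))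
    (u : EuclideanSpace ℝ (Fin n) → ℝ) (x : EuclideanSpace ℝ (Fin n)) : ℝ :=
  ∑ i : Fin n, iteratedFDerivWithin ℝ 2 u S x
    ![EuclideanSpace.single i 1, EuclideanSpace.single i 1]

/-- The second-order necessary condition for a local minimum. -/
theorem IsLocalMin.nonneg_of_hasDerivAt_hasDerivAt {g g' : ℝ → ℝ} {x₀ c : ℝ}
    (hmin : IsLocalMin g x₀) (hg : ∀ᶠ t in 𝓝 x₀, HasDerivAt g (g' t) t)
    (hg' : HasDerivAt g' c x₀) : 0 ≤ c := by
  by_contra! hc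
  have hderiv : deriv g =ᶠ[𝓝 x₀] g' := hg.mono fun t ht => ht.deriv
  have hmax : IsLocalMax g x₀ := by
    refine isLocalMax_of_deriv_deriv_neg ?_ hmin.deriv_eq_zero hg.self_of_nhds.continuousAt
    rwa [hderiv.deriv_eq, hg'.deriv]
  have hconst : g =ᶠ[𝓝 x₀] fun _ => g x₀ := by
    filter_upwards [hmin, hmax] with t h₁ h₂ using le_antisymm h₂ h₁
  have hzero : g' =ᶠ[𝓝 x₀] fun _ => 0 := by
    filter_upwards [hg, hconst.eventuallyEq_nhds] with t ht hct
    rw [← ht.deriv, hct.deriv_eq, deriv_const]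
  have : c = 0 := by rw [← hg'.deriv, hzero.deriv_eq, deriv_const]
  exact hc.ne this

/-- A function with a one-sided minimum at `0` has nonnegative one-sided derivative there. -/
theorem HasDerivWithinAt.nonneg_of_isMinOn_Ici {g : ℝ → ℝ} {c : ℝ}
    (hg : HasDerivWithinAt g c (Set.Ici 0) 0) (hmin : IsMinOn g (Set.Ici 0) 0) : 0 ≤ c := by
  have h := hmin.localize.hasFDerivWithinAt_nonneg hg.hasFDerivWithinAt (y := 1)
    (mem_posTangentConeAt_of_segment_subset <|
      (convex_Ici (0 : ℝ)).segment_subset (by simp) (by simp))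
  simpa using h

section HalfSpace

variable {n : ℕ}

theorem norm_add_smul_single_sq (x : EuclideanSpace ℝ (Fin n)) (i : Fin n) (t : ℝ) :
    ‖x + t • EuclideanSpace.single i (1 : ℝ)‖ ^ 2 = ‖x‖ ^ 2 + 2 * x i * t + t ^ 2 := by
  rw [norm_add_sq_real, inner_smul_right, EuclideanSpace.inner_single_right, norm_smul,
    PiLp.norm_single]
  simp
  ring

theorem hasDerivAt_line (x e : EuclideanSpace ℝ (Fin n)) (t : ℝ) :
    HasDerivAt (fun t : ℝ => x + t • e) e t := by
  simpa using ((hasDerivAt_id t).smul_const e).const_add x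

theorem hasDerivAt_one_add_norm_sq_rpow_line (x : EuclideanSpace ℝ (Fin n)) (i : Fin n)
    (a t : ℝ) :
    HasDerivAt (fun t : ℝ => (1 + ‖x + t • EuclideanSpace.single i (1 : ℝ)‖ ^ 2) ^ a)
      (2 * a * (x i + t) * (1 + ‖x + t • EuclideanSpace.single i (1 : ℝ)‖ ^ 2) ^ (a - 1)) t := by
  have h : HasDerivAt (fun t : ℝ => 1 + ‖x + t • EuclideanSpace.single i (1 : ℝ)‖ ^ 2)
      (2 * (x i + t)) t := by
    simp only [norm_add_smul_single_sq]
    refine HasDerivAt.congr_deriv ((((hasDerivAt_id t).const_mul (2 * x i)).const_add (‖x‖ ^ 2) |>.add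
      ((hasDerivAt_id t).pow 2)).const_add 1) ?_
    simp only [id]
    norm_num
    ring
  refine (h.rpow_const (p := a) (Or.inl (by positivity))).congr_deriv ?_
  ring

theorem hasDerivAt_apply_line (x : EuclideanSpace ℝ (Fin n)) (i k : Fin n) (t : ℝ) :
    HasDerivAt (fun t : ℝ => (x + t • EuclideanSpace.single i (1 : ℝ)) k)
      (if i = k then 1 else 0) t := by
  have : (fun t : ℝ => (x + t • EuclideanSpace.single i (1 : ℝ)) k) =
      fun t => x k + t * (if i = k then 1 else 0) := by
    funext t; simp [eq_comm]
  rw [this]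
  simpa using ((hasDerivAt_id t).mul_const (if i = k then (1 : ℝ) else 0)).const_add (x k)

/-- The comparison function `A (1 + |x|²)^a - x_k (1 + |x|²)^b`. -/
def barrier (A a b : ℝ) (k : Fin n) (x : EuclideanSpace ℝ (Fin n)) : ℝ :=
  A * (1 + ‖x‖ ^ 2) ^ a - x k * (1 + ‖x‖ ^ 2) ^ b

/-- The partial derivative of `barrier` in direction `i`. -/
def barrierDeriv (A a b : ℝ) (k i : Fin n) (x : EuclideanSpace ℝ (Fin n)) : ℝ :=
  A * (2 * a * x i * (1 + ‖x‖ ^ 2) ^ (a - 1)) -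
    ((if i = k then 1 else 0) * (1 + ‖x‖ ^ 2) ^ b +
      x k * (2 * b * x i * (1 + ‖x‖ ^ 2) ^ (b - 1)))

/-- The second partial derivative of `barrier` in direction `i`. -/
def barrierDerivTwo (A a b : ℝ) (k i : Fin n) (x : EuclideanSpace ℝ (Fin n)) : ℝ :=
  A * (2 * a * (1 + ‖x‖ ^ 2) ^ (a - 1) + 4 * a * (a - 1) * x i ^ 2 * (1 + ‖x‖ ^ 2) ^ (a - 2)) -
    (4 * b * ((if i = k then 1 else 0) * x i) * (1 + ‖x‖ ^ 2) ^ (b - 1) +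
      x k * (2 * b * (1 + ‖x‖ ^ 2) ^ (b - 1) +
        4 * b * (b - 1) * x i ^ 2 * (1 + ‖x‖ ^ 2) ^ (b - 2)))

theorem hasDerivAt_barrier_line (A a b : ℝ) (k i : Fin n) (x : EuclideanSpace ℝ (Fin n)) (t : ℝ) :
    HasDerivAt (fun t : ℝ => barrier A a b k (x + t • EuclideanSpace.single i (1 : ℝ)))
      (barrierDeriv A a b k i (x + t • EuclideanSpace.single i (1 : ℝ))) t := by
  have h := ((hasDerivAt_one_add_norm_sq_rpow_line x i a t).const_mul A).sub
    ((hasDerivAt_apply_line x i k t).mul (hasDerivAt_one_add_norm_sq_rpow_line x i b t))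
  refine HasDerivAt.congr_deriv h ?_
  simp [barrierDeriv]

theorem hasDerivAt_barrierDeriv_line (A a b : ℝ) (k i : Fin n) (x : EuclideanSpace ℝ (Fin n)) :
    HasDerivAt (fun t : ℝ => barrierDeriv A a b k i (x + t • EuclideanSpace.single i (1 : ℝ)))
      (barrierDerivTwo A a b k i x) 0 := by
  have hi := hasDerivAt_apply_line x i i 0
  have hk := hasDerivAt_apply_line x i k 0
  have hp := fun c => hasDerivAt_one_add_norm_sq_rpow_line x i c 0
  have h := (((hi.const_mul (2 * a)).mul (hp (a - 1))).const_mul A).sub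
    (((hp b).const_mul (if i = k then (1 : ℝ) else 0)).add
      (hk.mul ((hi.const_mul (2 * b)).mul (hp (b - 1)))))
  refine HasDerivAt.congr_deriv h ?_
  simp only [barrierDerivTwo, Pi.mul_apply, zero_smul, add_zero, if_true, sub_sub]
  norm_num
  split_ifs <;> ring

theorem sum_barrierDerivTwo (A a b : ℝ) (k : Fin n) (x : EuclideanSpace ℝ (Fin n)) :
    ∑ i, barrierDerivTwo A a b k i x =
      A * (2 * a * (1 + ‖x‖ ^ 2) ^ (a - 2) * (n + (n + 2 * a - 2) * ‖x‖ ^ 2)) -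
        2 * b * x k * (1 + ‖x‖ ^ 2) ^ (b - 2) * ((n + 2) + (n + 2 * b) * ‖x‖ ^ 2) := by
  have hs : (0 : ℝ) < 1 + ‖x‖ ^ 2 := by positivity
  have hpow : ∀ c : ℝ, (1 + ‖x‖ ^ 2) ^ (c - 1) = (1 + ‖x‖ ^ 2) ^ (c - 2) * (1 + ‖x‖ ^ 2) := by
    intro c
    rw [← Real.rpow_add_one hs.ne']
    congr 1; ring
  have hsq : ∑ i, x i ^ 2 = ‖x‖ ^ 2 := (EuclideanSpace.real_norm_sq_eq x).symm
  simp only [barrierDerivTwo, Finset.sum_sub_distrib, Finset.sum_add_distrib, ← Finset.mul_sum,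
    ← Finset.sum_mul, hsq, ite_mul, one_mul, zero_mul, Finset.sum_ite_eq', Finset.mem_univ, if_true,
    Finset.sum_const, Finset.card_univ, Fintype.card_fin, nsmul_eq_mul]
  rw [hpow a, hpow b]
  ring

theorem apply_mul_rpow_le (k : Fin n) (x : EuclideanSpace ℝ (Fin n)) (c : ℝ) :
    x k * (1 + ‖x‖ ^ 2) ^ (c - 1 / 2) ≤ (1 + ‖x‖ ^ 2) ^ c := by
  have hs : (0 : ℝ) < 1 + ‖x‖ ^ 2 := by positivity
  have hx : x k ≤ (1 + ‖x‖ ^ 2) ^ (1 / 2 : ℝ) := by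
    rw [← Real.sqrt_eq_rpow]
    refine (le_abs_self _).trans (Real.abs_le_sqrt ?_)
    have := EuclideanSpace.real_norm_sq_eq x
    have h2 : x k ^ 2 ≤ ∑ i, x i ^ 2 :=
      Finset.single_le_sum (f := fun i => x i ^ 2) (fun i _ => sq_nonneg _) (Finset.mem_univ k)
    linarith
  calc x k * (1 + ‖x‖ ^ 2) ^ (c - 1 / 2)
      ≤ (1 + ‖x‖ ^ 2) ^ (1 / 2 : ℝ) * (1 + ‖x‖ ^ 2) ^ (c - 1 / 2) := by gcongr
    _ = (1 + ‖x‖ ^ 2) ^ c := by rw [← Real.rpow_add hs]; congr 1; ring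

/-- `barrier` is a strict supersolution in the half-space as soon as `A` is large. -/
theorem sum_barrierDerivTwo_le {A a : ℝ} {k : Fin n} {x : EuclideanSpace ℝ (Fin n)} (ha : a < 0)
    (hA : 1 + (1 - 2 * a) * (n + 2) ≤ A * (-2 * a * (n + 2 * a - 2)))
    (hA0 : 0 ≤ A) (hx : 0 ≤ x k) :
    ∑ i, barrierDerivTwo A a (a - 1 / 2) k i x ≤ -(1 + ‖x‖ ^ 2) ^ (a - 1) := by
  have hs : (0 : ℝ) < 1 + ‖x‖ ^ 2 := by positivity
  have hpow : ∀ c : ℝ, (1 + ‖x‖ ^ 2) ^ (c - 1) = (1 + ‖x‖ ^ 2) ^ (c - 2) * (1 + ‖x‖ ^ 2) := by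
    intro c
    rw [← Real.rpow_add_one hs.ne']
    congr 1; ring
  have h₁ : (n + 2 * a - 2) * (1 + ‖x‖ ^ 2) ≤ n + (n + 2 * a - 2) * ‖x‖ ^ 2 := by nlinarith
  have h₂ : (n + 2) + (n + 2 * (a - 1 / 2)) * ‖x‖ ^ 2 ≤ (n + 2) * (1 + ‖x‖ ^ 2) := by
    nlinarith [sq_nonneg ‖x‖]
  have h₃ : A * (-2 * a * (n + 2 * a - 2)) * (1 + ‖x‖ ^ 2) ^ (a - 1) ≤
      A * (-2 * a * (1 + ‖x‖ ^ 2) ^ (a - 2) * (n + (n + 2 * a - 2) * ‖x‖ ^ 2)) := by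
    rw [hpow]
    have : 0 ≤ A * (-2 * a * (1 + ‖x‖ ^ 2) ^ (a - 2)) :=
      mul_nonneg hA0 (mul_nonneg (by linarith) (by positivity))
    nlinarith [mul_le_mul_of_nonneg_left h₁ this]
  have h₄ : (1 - 2 * a) * x k * (1 + ‖x‖ ^ 2) ^ (a - 1 / 2 - 2) *
        ((n + 2) + (n + 2 * (a - 1 / 2)) * ‖x‖ ^ 2) ≤
      (1 - 2 * a) * (n + 2) * (1 + ‖x‖ ^ 2) ^ (a - 1) := by
    have hc : 0 ≤ (1 - 2 * a) * x k * (1 + ‖x‖ ^ 2) ^ (a - 1 / 2 - 2) :=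
      mul_nonneg (mul_nonneg (by linarith) hx) (by positivity)
    have h := apply_mul_rpow_le k x (a - 1)
    rw [show a - 1 - 1 / 2 = a - 1 / 2 - 1 by ring, hpow] at h
    have h' : 0 ≤ (1 - 2 * a) * ((n : ℝ) + 2) := mul_nonneg (by linarith) (by positivity)
    nlinarith [mul_le_mul_of_nonneg_left h₂ hc, mul_le_mul_of_nonneg_left h h']
  rw [sum_barrierDerivTwo]
  have h₅ : (1 + (1 - 2 * a) * (n + 2)) * (1 + ‖x‖ ^ 2) ^ (a - 1) ≤
      A * (-2 * a * (n + 2 * a - 2)) * (1 + ‖x‖ ^ 2) ^ (a - 1) := by gcongr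
  linarith

theorem barrier_nonneg {A a : ℝ} (hA : 1 ≤ A) (k : Fin n) (x : EuclideanSpace ℝ (Fin n)) :
    0 ≤ barrier A a (a - 1 / 2) k x := by
  have hs : (0 : ℝ) < (1 + ‖x‖ ^ 2) ^ a := by positivity
  have := apply_mul_rpow_le k x a
  unfold barrier
  nlinarith

theorem continuous_barrier (A a b : ℝ) (k : Fin n) : Continuous (barrier A a b k) := by
  have h : ∀ c : ℝ, Continuous fun x : EuclideanSpace ℝ (Fin n) => (1 + ‖x‖ ^ 2) ^ c := fun c =>
    Continuous.rpow_const (by fun_prop) fun x => Or.inl (by positivity)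
  exact (continuous_const.mul (h a)).sub
    (((continuous_apply k).comp (PiLp.continuous_ofLp 2 _)).mul (h b))

theorem ContDiffAt.eventually_hasDerivAt_line {v : EuclideanSpace ℝ (Fin n) → ℝ}
    {x : EuclideanSpace ℝ (Fin n)} (hv : ContDiffAt ℝ 2 v x) (e : EuclideanSpace ℝ (Fin n)) :
    ∀ᶠ t : ℝ in 𝓝 0, HasDerivAt (fun t : ℝ => v (x + t • e)) (fderiv ℝ v (x + t • e) e) t := by
  have hc : Tendsto (fun t : ℝ => x + t • e) (𝓝 0) (𝓝 x) := by
    simpa using (hasDerivAt_line x e 0).continuousAt.tendsto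
  filter_upwards [hc.eventually (hv.eventually (by simp))] with t ht
  exact (ht.differentiableAt (by simp)).hasFDerivAt.comp_hasDerivAt t (hasDerivAt_line x e t)

theorem ContDiffAt.hasDerivAt_fderiv_line {v : EuclideanSpace ℝ (Fin n) → ℝ}
    {x : EuclideanSpace ℝ (Fin n)} (hv : ContDiffAt ℝ 2 v x) (e : EuclideanSpace ℝ (Fin n)) :
    HasDerivAt (fun t : ℝ => fderiv ℝ v (x + t • e) e) (iteratedFDeriv ℝ 2 v x ![e, e]) 0 := by
  have hd : DifferentiableAt ℝ (fderiv ℝ v) (x + (0 : ℝ) • e) := by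
    simpa using (hv.fderiv_right (m := 1) (by norm_num)).differentiableAt (by simp)
  have h := hd.hasFDerivAt.comp_hasDerivAt (0 : ℝ) (hasDerivAt_line x e 0)
  have h' := (ContinuousLinearMap.apply ℝ ℝ e).hasFDerivAt.comp_hasDerivAt (0 : ℝ) h
  simpa [iteratedFDeriv_two_apply, Function.comp_def] using h'

theorem convex_upperHalf (k : Fin n) : Convex ℝ (upperHalf n k) :=
  (convex_Ici (0 : ℝ)).linear_preimage (EuclideanSpace.proj (𝕜 := ℝ) k).toLinearMap

theorem continuous_coord (k : Fin n) : Continuous fun x : EuclideanSpace ℝ (Fin n) => x k :=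
  (EuclideanSpace.proj (𝕜 := ℝ) k).continuous

theorem isClosed_upperHalf (k : Fin n) : IsClosed (upperHalf n k) :=
  isClosed_le continuous_const (continuous_coord k)

theorem upperHalf_mem_nhds {k : Fin n} {x : EuclideanSpace ℝ (Fin n)} (hx : 0 < x k) :
    upperHalf n k ∈ 𝓝 x :=
  mem_of_superset ((isOpen_lt continuous_const (continuous_coord k)).mem_nhds hx)
    fun y (hy : 0 < y k) => hy.le

theorem uniqueDiffOn_upperHalf (k : Fin n) : UniqueDiffOn ℝ (upperHalf n k) :=
  uniqueDiffOn_convex (convex_upperHalf k)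
    ⟨EuclideanSpace.single k 1, mem_interior_iff_mem_nhds.2 (upperHalf_mem_nhds (by simp))⟩

/-- At an interior local minimum of `c • barrier - v`, the Laplacians are ordered. -/
theorem lapWithin_le_of_isMinOn {A a b c : ℝ} {k : Fin n} {v : EuclideanSpace ℝ (Fin n) → ℝ}
    {x : EuclideanSpace ℝ (Fin n)} (hv : ContDiffOn ℝ 2 v (upperHalf n k)) (hx : 0 < x k)
    (hmin : IsMinOn (fun z => c * barrier A a b k z - v z) (upperHalf n k) x) :
    lapWithin n (upperHalf n k) v x ≤ c * ∑ i, barrierDerivTwo A a b k i x := by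
  have hnhds := upperHalf_mem_nhds hx
  have hvx : ContDiffAt ℝ 2 v x := hv.contDiffAt hnhds
  rw [lapWithin, iteratedFDerivWithin_eq_iteratedFDeriv (uniqueDiffOn_upperHalf k)
    (by exact_mod_cast hvx) hx.le, Finset.mul_sum]
  refine Finset.sum_le_sum fun i _ => ?_
  set e : EuclideanSpace ℝ (Fin n) := EuclideanSpace.single i 1
  have hcont : Tendsto (fun t : ℝ => x + t • e) (𝓝 0) (𝓝 x) := by
    simpa using (hasDerivAt_line x e 0).continuousAt.tendsto
  have hloc : IsLocalMin (fun t : ℝ => c * barrier A a b k (x + t • e) - v (x + t • e)) 0 := by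
    have := hcont.eventually (hmin.isLocalMin hnhds)
    simpa [IsLocalMin, IsMinFilter] using this
  have := hloc.nonneg_of_hasDerivAt_hasDerivAt
    ((hvx.eventually_hasDerivAt_line e).mono fun t ht =>
      ((hasDerivAt_barrier_line A a b k i x t).const_mul c).sub ht)
    (((hasDerivAt_barrierDeriv_line A a b k i x).const_mul c).sub (hvx.hasDerivAt_fderiv_line e))
  linarith

/-- At a boundary minimum of `c • barrier - v`, the normal derivatives are ordered. -/
theorem fderivWithin_le_of_isMinOn {A a b c : ℝ} {k : Fin n} {v : EuclideanSpace ℝ (Fin n) → ℝ}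
    {x : EuclideanSpace ℝ (Fin n)} (hv : ContDiffOn ℝ 2 v (upperHalf n k)) (hx : x k = 0)
    (hmin : IsMinOn (fun z => c * barrier A a b k z - v z) (upperHalf n k) x) :
    fderivWithin ℝ v (upperHalf n k) x (EuclideanSpace.single k 1) ≤
      -(c * (1 + ‖x‖ ^ 2) ^ b) := by
  set e : EuclideanSpace ℝ (Fin n) := EuclideanSpace.single k 1 with he
  have hmaps : Set.MapsTo (fun t : ℝ => x + t • e) (Set.Ici 0) (upperHalf n k) := by
    intro t ht
    simpa [upperHalf, he, hx] using ht
  have hv' : HasFDerivWithinAt v (fderivWithin ℝ v (upperHalf n k) x) (upperHalf n k)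
      (x + (0 : ℝ) • e) := by
    simpa using (hv.differentiableOn (by simp) x hx.ge).hasFDerivWithinAt
  have hd := ((hasDerivAt_barrier_line A a b k k x 0).const_mul c).hasDerivWithinAt.sub
    (hv'.comp_hasDerivWithinAt (0 : ℝ) (hasDerivAt_line x e 0).hasDerivWithinAt hmaps)
  have h := hd.nonneg_of_isMinOn_Ici (fun t ht => by simpa using hmin (hmaps ht))
  simp only [barrierDeriv, zero_smul, add_zero, hx, if_true] at h
  linarith

theorem rpow_le_one_add_norm_sq_rpow (x : EuclideanSpace ℝ (Fin n)) {c : ℝ} (hc : c ≤ 0) :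
    (1 + ‖x‖) ^ (2 * c) ≤ (1 + ‖x‖ ^ 2) ^ c := by
  rw [Real.rpow_mul (by positivity)]
  refine Real.rpow_le_rpow_of_nonpos (by positivity) ?_ hc
  rw [Real.rpow_two]
  nlinarith [norm_nonneg x]

theorem one_add_norm_sq_rpow_le (x : EuclideanSpace ℝ (Fin n)) {c : ℝ} (hc : c ≤ 0) :
    (1 + ‖x‖ ^ 2) ^ c ≤ 2 ^ (-c) * (1 + ‖x‖) ^ (2 * c) := by
  have h : ((1 + ‖x‖) ^ 2 / 2) ^ c = 2 ^ (-c) * (1 + ‖x‖) ^ (2 * c) := by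
    rw [Real.div_rpow (by positivity) (by norm_num), Real.rpow_mul (by positivity),
      Real.rpow_two, Real.rpow_neg (by norm_num)]
    field_simp
  rw [← h]
  refine Real.rpow_le_rpow_of_nonpos (by positivity) ?_ hc
  nlinarith [sq_nonneg (1 - ‖x‖)]

/-- The comparison principle for the Neumann problem on the half-space with decaying data. -/
theorem le_mul_barrier {A a M K₁ K₂ : ℝ} {k : Fin n} {v : EuclideanSpace ℝ (Fin n) → ℝ}
    (ha : a < 0)
    (hA : 1 + (1 - 2 * a) * (n + 2) ≤ A * (-2 * a * (n + 2 * a - 2))) (hA1 : 1 ≤ A)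
    (hK₁ : 0 ≤ K₁) (hK₂ : 0 ≤ K₂) (hv : ContDiffOn ℝ 2 v (upperHalf n k))
    (hM : ∀ x ∈ upperHalf n k, v x ≤ M * (1 + ‖x‖) ^ (2 * a))
    (hlap : ∀ x ∈ upperHalf n k,
      -(K₁ * (1 + ‖x‖) ^ (2 * a - 2)) ≤ lapWithin n (upperHalf n k) v x)
    (hbd : ∀ x ∈ bdryPlane n k, -(K₂ * (1 + ‖x‖) ^ (2 * a - 1)) ≤
      fderivWithin ℝ v (upperHalf n k) x (EuclideanSpace.single k 1))
    {y : EuclideanSpace ℝ (Fin n)} (hy : y ∈ upperHalf n k) :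
    v y ≤ (K₁ + K₂) * barrier A a (a - 1 / 2) k y := by
  have main : ∀ c > K₁ + K₂, v y ≤ c * barrier A a (a - 1 / 2) k y := by
    intro c hc
    by_contra! hlt
    set f : EuclideanSpace ℝ (Fin n) → ℝ := fun z => c * barrier A a (a - 1 / 2) k z - v z with hf
    have hfy : f y < 0 := sub_neg.2 hlt
    have hdecay : Tendsto (fun x : EuclideanSpace ℝ (Fin n) => -(M * (1 + ‖x‖) ^ (2 * a)))
        (cocompact _) (𝓝 0) := by
      have h₁ : Tendsto (fun x : EuclideanSpace ℝ (Fin n) => 1 + ‖x‖) (cocompact _) atTop :=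
        tendsto_atTop_add_const_left _ _ (tendsto_norm_cocompact_atTop)
      have h₂ := (tendsto_rpow_neg_atTop (y := -(2 * a)) (by linarith)).comp h₁
      simpa [Function.comp_def] using (h₂.const_mul M).neg
    have hev : ∀ᶠ x in cocompact _ ⊓ 𝓟 (upperHalf n k), f y ≤ f x := by
      rw [eventually_inf_principal]
      filter_upwards [hdecay.eventually (lt_mem_nhds hfy)] with x hx hxk
      have h₁ := mul_nonneg (by linarith : (0 : ℝ) ≤ c) (barrier_nonneg (a := a) hA1 k x)
      have h₂ := hM x hxk
      simp only [hf] at hx ⊢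
      linarith
    obtain ⟨x, hx, hmin⟩ := ContinuousOn.exists_isMinOn'
      (((continuous_barrier A a (a - 1 / 2) k).const_mul c).continuousOn.sub hv.continuousOn)
      (isClosed_upperHalf k) hy hev
    rcases (show 0 ≤ x k from hx).lt_or_eq with hpos | hzero
    · have h₁ := lapWithin_le_of_isMinOn hv hpos hmin
      have h₂ := sum_barrierDerivTwo_le ha hA (by linarith) hx
      have h₃ := rpow_le_one_add_norm_sq_rpow x (c := a - 1) (by linarith)
      have h₄ := hlap x hx
      have h₅ : (0 : ℝ) < (1 + ‖x‖ ^ 2) ^ (a - 1) := by positivity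
      rw [show 2 * (a - 1) = 2 * a - 2 by ring] at h₃
      nlinarith
    · have h₁ := fderivWithin_le_of_isMinOn hv hzero.symm hmin
      have h₃ := rpow_le_one_add_norm_sq_rpow x (c := a - 1 / 2) (by linarith)
      have h₄ := hbd x hzero.symm
      have h₅ : (0 : ℝ) < (1 + ‖x‖ ^ 2) ^ (a - 1 / 2) := by positivity
      rw [show 2 * (a - 1 / 2) = 2 * a - 1 by ring] at h₃
      nlinarith
  have hcont : Tendsto (fun c : ℝ => c * barrier A a (a - 1 / 2) k y) (𝓝[>] (K₁ + K₂))
      (𝓝 ((K₁ + K₂) * barrier A a (a - 1 / 2) k y)) :=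
    ((continuous_id.mul continuous_const).tendsto _).mono_left nhdsWithin_le_nhds
  exact ge_of_tendsto hcont (eventually_mem_nhdsWithin.mono main)

theorem abs_lapWithin_le (S : Set (EuclideanSpace ℝ (Fin n))) (u : EuclideanSpace ℝ (Fin n) → ℝ)
    (x : EuclideanSpace ℝ (Fin n)) :
    |lapWithin n S u x| ≤ n * ‖iteratedFDerivWithin ℝ 2 u S x‖ := by
  refine (Finset.abs_sum_le_sum_abs _ _).trans ?_
  refine (Finset.sum_le_card_nsmul _ _ ‖iteratedFDerivWithin ℝ 2 u S x‖ fun i _ => ?_).trans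
    (by simp)
  simpa [Fin.prod_univ_two] using (iteratedFDerivWithin ℝ 2 u S x).le_opNorm
    ![EuclideanSpace.single i 1, EuclideanSpace.single i 1]

theorem lapWithin_neg {k : Fin n} {u : EuclideanSpace ℝ (Fin n) → ℝ}
    {x : EuclideanSpace ℝ (Fin n)} (hx : x ∈ upperHalf n k) :
    lapWithin n (upperHalf n k) (-u) x = -lapWithin n (upperHalf n k) u x := by
  simp [lapWithin, iteratedFDerivWithin_neg_apply (uniqueDiffOn_upperHalf k) hx]

theorem le_mul_rpow_of_rpow_mul_le {r c t K : ℝ} (hr : 0 < r) (h : r ^ (-c) * t ≤ K) :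
    t ≤ K * r ^ c := by
  have := mul_le_mul_of_nonneg_right h (Real.rpow_nonneg hr.le c)
  rwa [mul_right_comm, ← Real.rpow_add hr, neg_add_cancel, Real.rpow_zero, one_mul] at this

theorem abs_le_of_memCgamma {γ A : ℝ} {k : Fin n} (hγ : γ < 0)
    (hA : 1 + (1 - γ) * (n + 2) ≤ A * (-γ * (n + γ - 2))) (hA1 : 1 ≤ A)
    {u : EuclideanSpace ℝ (Fin n) → ℝ} (hu : MemCgamma n 2 γ (upperHalf n k) u)
    {y : EuclideanSpace ℝ (Fin n)} (hy : y ∈ upperHalf n k) :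
    |u y| ≤ (sSup {t : ℝ | ∃ x ∈ upperHalf n k,
          t = (1 + ‖x‖) ^ (-γ + 2) * |lapWithin n (upperHalf n k) u x|} +
        sSup {t : ℝ | ∃ x ∈ bdryPlane n k, t = (1 + ‖x‖) ^ (-γ + 1) *
          |fderivWithin ℝ u (upperHalf n k) x (EuclideanSpace.single k 1)|}) *
      barrier A (γ / 2) (γ / 2 - 1 / 2) k y := by
  obtain ⟨hsmooth, hbound⟩ := hu
  set K₁ := sSup {t : ℝ | ∃ x ∈ upperHalf n k,
    t = (1 + ‖x‖) ^ (-γ + 2) * |lapWithin n (upperHalf n k) u x|} with hK₁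
  set K₂ := sSup {t : ℝ | ∃ x ∈ bdryPlane n k, t = (1 + ‖x‖) ^ (-γ + 1) *
    |fderivWithin ℝ u (upperHalf n k) x (EuclideanSpace.single k 1)|} with hK₂
  have hK₁0 : 0 ≤ K₁ := Real.sSup_nonneg (by rintro _ ⟨x, -, rfl⟩; positivity)
  have hK₂0 : 0 ≤ K₂ := Real.sSup_nonneg (by rintro _ ⟨x, -, rfl⟩; positivity)
  obtain ⟨M₀, hM₀⟩ := hbound 0 (by norm_num)
  obtain ⟨M₁, hM₁⟩ := hbound 1 (by norm_num)
  obtain ⟨M₂, hM₂⟩ := hbound 2 le_rfl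
  have hlap : ∀ x ∈ upperHalf n k,
      |lapWithin n (upperHalf n k) u x| ≤ K₁ * (1 + ‖x‖) ^ (γ - 2) := by
    intro x hx
    refine le_mul_rpow_of_rpow_mul_le (by positivity) ?_
    rw [neg_sub', sub_neg_eq_add]
    refine le_csSup ⟨n * M₂, ?_⟩ ⟨x, hx, rfl⟩
    rintro _ ⟨z, hz, rfl⟩
    calc (1 + ‖z‖) ^ (-γ + 2) * |lapWithin n (upperHalf n k) u z|
        ≤ (1 + ‖z‖) ^ (-γ + 2) * (n * ‖iteratedFDerivWithin ℝ 2 u (upperHalf n k) z‖) := by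
          gcongr; exact abs_lapWithin_le _ _ _
      _ = n * ((1 + ‖z‖) ^ (-γ + 2) * ‖iteratedFDerivWithin ℝ 2 u (upperHalf n k) z‖) := by ring
      _ ≤ n * M₂ := by
          gcongr; exact_mod_cast hM₂ z hz
  have hbd : ∀ x ∈ bdryPlane n k,
      |fderivWithin ℝ u (upperHalf n k) x (EuclideanSpace.single k 1)| ≤
        K₂ * (1 + ‖x‖) ^ (γ - 1) := by
    intro x hx
    refine le_mul_rpow_of_rpow_mul_le (by positivity) ?_
    rw [neg_sub', sub_neg_eq_add]
    refine le_csSup ⟨M₁, ?_⟩ ⟨x, hx, rfl⟩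
    rintro _ ⟨z, hz, rfl⟩
    have hzk : z ∈ upperHalf n k := (show z k = 0 from hz).ge
    have h := hM₁ z hzk
    rw [norm_iteratedFDerivWithin_one u (uniqueDiffOn_upperHalf k z hzk), Nat.cast_one] at h
    refine le_trans ?_ h
    gcongr
    simpa using (fderivWithin ℝ u (upperHalf n k) z).le_opNorm (EuclideanSpace.single k 1)
  have hval : ∀ x ∈ upperHalf n k, |u x| ≤ M₀ * (1 + ‖x‖) ^ γ := fun x hx =>
    le_mul_rpow_of_rpow_mul_le (by positivity) (by simpa using hM₀ x hx)
  have ha2 : 2 * (γ / 2) = γ := by ring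
  have hA' : 1 + (1 - 2 * (γ / 2)) * (n + 2) ≤ A * (-2 * (γ / 2) * (n + 2 * (γ / 2) - 2)) := by
    rw [neg_mul, ha2]; exact hA
  rw [abs_le']
  constructor
  · exact le_mul_barrier (M := M₀) (by linarith) hA' hA1 hK₁0 hK₂0 hsmooth
      (fun x hx => by rw [ha2]; exact (abs_le.1 (hval x hx)).2)
      (fun x hx => by rw [ha2]; exact (abs_le.1 (hlap x hx)).1)
      (fun x hx => by rw [ha2]; exact (abs_le.1 (hbd x hx)).1) hy
  · refine le_mul_barrier (M := M₀) (v := -u) (by linarith) hA' hA1 hK₁0 hK₂0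
      hsmooth.neg
      (fun x hx => by rw [ha2, Pi.neg_apply]; linarith [(abs_le.1 (hval x hx)).1])
      (fun x hx => by rw [ha2, lapWithin_neg hx]; linarith [(abs_le.1 (hlap x hx)).2])
      (fun x hx => ?_) hy
    rw [ha2, fderivWithin_neg (uniqueDiffOn_upperHalf k x (show x k = 0 from hx).ge),
      _root_.neg_apply]
    linarith [(abs_le.1 (hbd x hx)).2]

end HalfSpace

/-- for `n ≥ 3` and `2 - n < γ < 0` there is `C = C(n, γ) > 0` such that every
`u ∈ C²_γ(ℝⁿ₊)` satisfies
`sup ρ^{-γ}|u| ≤ C · sup ρ^{-γ+2}|Δu| + C · sup_{∂ℝⁿ₊} ρ^{-γ+1}|∂u/∂xₙ|`. -/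
theorem stmt_0 (n : ℕ) (hn : 3 ≤ n) (γ : ℝ) (hγ₁ : 2 - (n : ℝ) < γ) (hγ₂ : γ < 0) :
    ∃ C : ℝ, 0 < C ∧
      ∀ u : EuclideanSpace ℝ (Fin n) → ℝ,
        MemCgamma n 2 γ (upperHalf n ⟨n - 1, by omega⟩) u →
        ∀ y ∈ upperHalf n ⟨n - 1, by omega⟩,
          (1 + ‖y‖) ^ (-γ) * |u y| ≤
            C * sSup {t : ℝ | ∃ x ∈ upperHalf n ⟨n - 1, by omega⟩,
                t = (1 + ‖x‖) ^ (-γ + 2) *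
                  |lapWithin n (upperHalf n ⟨n - 1, by omega⟩) u x|} +
            C * sSup {t : ℝ | ∃ x ∈ bdryPlane n ⟨n - 1, by omega⟩,
                t = (1 + ‖x‖) ^ (-γ + 1) *
                  |fderivWithin ℝ u (upperHalf n ⟨n - 1, by omega⟩) x
                    (EuclideanSpace.single ⟨n - 1, by omega⟩ 1)|} := by
  have hc : 0 < -γ * (n + γ - 2) := mul_pos (by linarith) (by linarith)
  set A : ℝ := 1 + (1 + (1 - γ) * (n + 2)) / (-γ * (n + γ - 2)) with hAdef
  have hnum : 0 ≤ 1 + (1 - γ) * ((n : ℝ) + 2) := by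
    have : 0 ≤ (1 - γ) * ((n : ℝ) + 2) := mul_nonneg (by linarith) (by positivity)
    linarith
  have hA1 : 1 ≤ A := le_add_of_nonneg_right (div_nonneg hnum hc.le)
  have hA : 1 + (1 - γ) * (n + 2) ≤ A * (-γ * (n + γ - 2)) := by
    rw [hAdef, add_mul, div_mul_cancel₀ _ hc.ne']
    linarith
  refine ⟨A * 2 ^ (-(γ / 2)), by positivity, fun u hu y hy => ?_⟩
  have h := abs_le_of_memCgamma hγ₂ hA hA1 hu hy
  rw [← mul_add, mul_comm (A * _)]
  set K := sSup {t : ℝ | ∃ x ∈ upperHalf n ⟨n - 1, by omega⟩, t = (1 + ‖x‖) ^ (-γ + 2) *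
        |lapWithin n (upperHalf n ⟨n - 1, by omega⟩) u x|} +
      sSup {t : ℝ | ∃ x ∈ bdryPlane n ⟨n - 1, by omega⟩, t = (1 + ‖x‖) ^ (-γ + 1) *
        |fderivWithin ℝ u (upperHalf n ⟨n - 1, by omega⟩) x
          (EuclideanSpace.single ⟨n - 1, by omega⟩ 1)|}
  have hK : 0 ≤ K := add_nonneg
    (Real.sSup_nonneg (by rintro _ ⟨x, -, rfl⟩; positivity))
    (Real.sSup_nonneg (by rintro _ ⟨x, -, rfl⟩; positivity))
  have hbar : barrier A (γ / 2) (γ / 2 - 1 / 2) ⟨n - 1, by omega⟩ y ≤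
      A * 2 ^ (-(γ / 2)) * (1 + ‖y‖) ^ γ := by
    have h₁ := one_add_norm_sq_rpow_le y (c := γ / 2) (by linarith)
    rw [show 2 * (γ / 2) = γ by ring] at h₁
    have h₂ : 0 ≤ y ⟨n - 1, by omega⟩ * (1 + ‖y‖ ^ 2) ^ (γ / 2 - 1 / 2) :=
      mul_nonneg hy (by positivity)
    rw [barrier]
    nlinarith [mul_le_mul_of_nonneg_left h₁ (by linarith : 0 ≤ A)]
  have hle : |u y| ≤ K * (A * 2 ^ (-(γ / 2)) * (1 + ‖y‖) ^ γ) :=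
    h.trans (mul_le_mul_of_nonneg_left hbar hK)
  calc (1 + ‖y‖) ^ (-γ) * |u y|
      ≤ (1 + ‖y‖) ^ (-γ) * (K * (A * 2 ^ (-(γ / 2)) * (1 + ‖y‖) ^ γ)) := by gcongr
    _ = K * (A * 2 ^ (-(γ / 2))) * ((1 + ‖y‖) ^ (-γ) * (1 + ‖y‖) ^ γ) := by ring
    _ = K * (A * 2 ^ (-(γ / 2))) := by
      rw [← Real.rpow_add (by positivity), neg_add_cancel, Real.rpow_zero, mul_one]
end
end

section
/- Let n ≥ 3 and 2−n < γ < 0. There exists a constant C > 0, depending only on n and γ, such that for every y ∈ ℝⁿ with y ≠ 0 one has ∫_{ℝ^{n−1}} |(x′,0) − y|^{2−n} |x′|^{γ−1} dx′ ≤ C |y|^γ, where the integral is over the boundary hyperplane {xₙ = 0} with its (n−1)-dimensional Lebesgue measure. -/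
open MeasureTheory Metric Filter
open scoped ENNReal Topology

noncomputable section

section RadialIntegrals

open Module Set

variable {W : Type*} [NormedAddCommGroup W] [NormedSpace ℝ W] [FiniteDimensional ℝ W]
  [MeasurableSpace W] [BorelSpace W] [Nontrivial W]

/-- Polar coordinates for the power `‖w‖ ^ (-s)` cut off to radii in `S`. -/
lemma lintegral_indicator_rpow_norm (μ : Measure W) [μ.IsAddHaarMeasure] {S : Set ℝ}
    (hS : MeasurableSet S) {s : ℝ}
    (hint : IntegrableOn (fun t : ℝ => t ^ ((finrank ℝ W : ℝ) - 1 - s)) (Ioi 0 ∩ S)) :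
    ∫⁻ w, ENNReal.ofReal (S.indicator (· ^ (-s)) ‖w‖) ∂μ =
      ENNReal.ofReal (finrank ℝ W * μ.real (ball 0 1) *
        ∫ t in Ioi 0 ∩ S, t ^ ((finrank ℝ W : ℝ) - 1 - s)) := by
  have key : EqOn (fun t : ℝ => t ^ (finrank ℝ W - 1) • S.indicator (· ^ (-s)) t)
      (S.indicator fun t => t ^ ((finrank ℝ W : ℝ) - 1 - s)) (Ioi 0) := by
    intro t ht
    have ht : 0 < t := ht
    by_cases htS : t ∈ S
    · simp only [htS, indicator_of_mem, smul_eq_mul]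
      rw [← Real.rpow_natCast, ← Real.rpow_add ht, Nat.cast_sub finrank_pos]
      congr 1
      push_cast
      ring
    · simp [htS]
  have hint' : Integrable (fun w => S.indicator (· ^ (-s)) ‖w‖) μ := by
    rw [integrable_fun_norm_addHaar μ (f := S.indicator (· ^ (-s))),
      integrableOn_congr_fun key measurableSet_Ioi, IntegrableOn, integrable_indicator_iff hS,
      IntegrableOn, Measure.restrict_restrict hS, inter_comm]
    exact hint
  rw [← ofReal_integral_eq_lintegral_ofReal hint', integral_fun_norm_addHaar μ,
    setIntegral_congr_fun measurableSet_Ioi key, setIntegral_indicator hS, nsmul_eq_mul,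
    smul_eq_mul, mul_assoc]
  refine ae_of_all _ fun w => indicator_apply_nonneg fun _ => ?_
  positivity

lemma lintegral_indicator_Iic_rpow_norm (μ : Measure W) [μ.IsAddHaarMeasure] {s r : ℝ}
    (hs : s < finrank ℝ W) (hr : 0 < r) :
    ∫⁻ w, ENNReal.ofReal ((Iic r).indicator (· ^ (-s)) ‖w‖) ∂μ =
      ENNReal.ofReal (finrank ℝ W * μ.real (ball 0 1) *
        (r ^ ((finrank ℝ W : ℝ) - s) / (finrank ℝ W - s))) := by
  have hexp : (-1 : ℝ) < (finrank ℝ W : ℝ) - 1 - s := by linarith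
  rw [lintegral_indicator_rpow_norm μ measurableSet_Iic, Ioi_inter_Iic,
    ← intervalIntegral.integral_of_le hr.le, integral_rpow (Or.inl hexp), Real.zero_rpow]
  · ring_nf
  · linarith
  · rw [Ioi_inter_Iic, ← intervalIntegrable_iff_integrableOn_Ioc_of_le hr.le]
    exact intervalIntegral.intervalIntegrable_rpow' hexp

lemma lintegral_indicator_Ioi_rpow_norm (μ : Measure W) [μ.IsAddHaarMeasure] {s r : ℝ}
    (hs : finrank ℝ W < s) (hr : 0 < r) :
    ∫⁻ w, ENNReal.ofReal ((Ioi r).indicator (· ^ (-s)) ‖w‖) ∂μ =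
      ENNReal.ofReal (finrank ℝ W * μ.real (ball 0 1) *
        (r ^ ((finrank ℝ W : ℝ) - s) / (s - finrank ℝ W))) := by
  have hexp : (finrank ℝ W : ℝ) - 1 - s < -1 := by linarith
  have hinter : Ioi (0 : ℝ) ∩ Ioi r = Ioi r := inter_eq_right.2 (Ioi_subset_Ioi hr.le)
  rw [lintegral_indicator_rpow_norm μ measurableSet_Ioi, hinter, integral_Ioi_rpow_of_lt hexp hr]
  · rw [show (finrank ℝ W : ℝ) - 1 - s + 1 = -(s - finrank ℝ W) by ring, neg_div_neg_eq, neg_sub]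
  · rw [hinter]
    exact integrableOn_Ioi_rpow_of_lt hexp hr

end RadialIntegrals

/-- The three regions in which one of the two factors of a two-centre kernel is controlled;
`δ`, `ρ`, `q` stand for the distances of a point `w` to `y`, to `0` and to a point which is closer
to `w` than `y` is. -/
lemma rpow_mul_rpow_le_sum_indicator {a b r δ ρ q : ℝ} (ha : 0 < a) (hb : 0 < b) (hr : 0 < r)
    (hρ : 0 < ρ) (hq : 0 < q) (hqδ : q ≤ δ) (h₁ : 2 * r ≤ δ + ρ) (h₂ : ρ ≤ δ + 2 * r) :
    δ ^ (-a) * ρ ^ (-b) ≤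
      r ^ (-a) * (Set.Iic r).indicator (· ^ (-b)) ρ +
      r ^ (-b) * (Set.Iic r).indicator (· ^ (-a)) q +
      3 ^ a * (Set.Ioi r).indicator (· ^ (-(a + b))) ρ := by
  have hδ : 0 < δ := hq.trans_le hqδ
  have hnn (S : Set ℝ) (s : ℝ) {t : ℝ} (ht : 0 < t) : 0 ≤ S.indicator (· ^ (-s)) t :=
    Set.indicator_apply_nonneg fun _ => Real.rpow_nonneg ht.le _
  have n₁ := mul_nonneg (Real.rpow_nonneg hr.le (-a)) (hnn (Set.Iic r) b hρ)
  have n₂ := mul_nonneg (Real.rpow_nonneg hr.le (-b)) (hnn (Set.Iic r) a hq)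
  have n₃ := mul_nonneg (Real.rpow_nonneg (zero_le_three (α := ℝ)) a) (hnn (Set.Ioi r) (a + b) hρ)
  rcases le_or_gt ρ r with hρr | hρr
  · have : δ ^ (-a) * ρ ^ (-b) ≤ r ^ (-a) * (Set.Iic r).indicator (· ^ (-b)) ρ := by
      rw [Set.indicator_of_mem (Set.mem_Iic.2 hρr)]
      gcongr ?_ * _
      exact Real.rpow_le_rpow_of_nonpos hr (by linarith) (by linarith)
    linarith
  rcases le_or_gt δ r with hδr | hδr
  · have : δ ^ (-a) * ρ ^ (-b) ≤ r ^ (-b) * (Set.Iic r).indicator (· ^ (-a)) q := by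
      rw [Set.indicator_of_mem (Set.mem_Iic.2 (hqδ.trans hδr)), mul_comm]
      gcongr ?_ * ?_
      · exact Real.rpow_le_rpow_of_nonpos hr hρr.le (by linarith)
      · exact Real.rpow_le_rpow_of_nonpos hq hqδ (by linarith)
    linarith
  · have : δ ^ (-a) * ρ ^ (-b) ≤ 3 ^ a * (Set.Ioi r).indicator (· ^ (-(a + b))) ρ := by
      rw [Set.indicator_of_mem (Set.mem_Ioi.2 hρr)]
      have hle : δ ^ (-a) ≤ (ρ / 3) ^ (-a) :=
        Real.rpow_le_rpow_of_nonpos (by positivity) (by linarith) (by linarith)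
      calc δ ^ (-a) * ρ ^ (-b) ≤ (ρ / 3) ^ (-a) * ρ ^ (-b) := by gcongr
        _ = 3 ^ a * ρ ^ (-(a + b)) := by
          rw [Real.div_rpow hρ.le zero_le_three, Real.rpow_neg zero_le_three, div_inv_eq_mul,
            neg_add, Real.rpow_add hρ]
          ring
    linarith

/-- Riesz-type composition estimate over a subspace `W`, with one centre at `0` and the other one
anywhere in the ambient space. -/
theorem exists_lintegral_submodule_rpow_mul_rpow_le {E : Type*} [NormedAddCommGroup E]
    [InnerProductSpace ℝ E] (W : Submodule ℝ E) [FiniteDimensional ℝ W] [Nontrivial W]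
    [MeasurableSpace W] [BorelSpace W] (μ : Measure W) [μ.IsAddHaarMeasure] {a b : ℝ}
    (ha₀ : 0 < a) (ha : a < Module.finrank ℝ W) (hb₀ : 0 < b) (hb : b < Module.finrank ℝ W)
    (hab : Module.finrank ℝ W < a + b) :
    ∃ C : ℝ, 0 < C ∧ ∀ y : E, y ≠ 0 →
      ∫⁻ w : W, ENNReal.ofReal (‖(w : E) - y‖ ^ (-a) * ‖(w : E)‖ ^ (-b)) ∂μ ≤
        ENNReal.ofReal (C * ‖y‖ ^ ((Module.finrank ℝ W : ℝ) - a - b)) := by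
  set d : ℝ := (Module.finrank ℝ W : ℝ) with hd
  set V : ℝ := d * μ.real (ball 0 1) with hV
  have hVpos : 0 < V :=
    mul_pos (ha₀.trans ha) (ENNReal.toReal_pos (measure_ball_pos μ 0 one_pos).ne'
      measure_ball_lt_top.ne)
  have had := sub_pos.2 ha
  have hbd := sub_pos.2 hb
  have habd := sub_pos.2 hab
  refine ⟨V * (1 / (d - b) + 1 / (d - a) + 3 ^ a / (a + b - d)) * (1 / 2) ^ (d - a - b),
    by positivity, fun y hy => ?_⟩
  set r : ℝ := 1 / 2 * ‖y‖ with hr_def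
  have hr : 0 < r := by have := norm_pos_iff.2 hy; positivity
  set p : W := W.orthogonalProjectionOnto y
  have hpt : ∀ᵐ w : W ∂μ,
      ENNReal.ofReal (‖(w : E) - y‖ ^ (-a) * ‖(w : E)‖ ^ (-b)) ≤
        ENNReal.ofReal (r ^ (-a)) * ENNReal.ofReal ((Set.Iic r).indicator (· ^ (-b)) ‖w‖) +
        ENNReal.ofReal (r ^ (-b)) * ENNReal.ofReal ((Set.Iic r).indicator (· ^ (-a)) ‖w - p‖) +
        ENNReal.ofReal (3 ^ a) * ENNReal.ofReal ((Set.Ioi r).indicator (· ^ (-(a + b))) ‖w‖) := by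
    filter_upwards [Measure.ae_ne μ 0, Measure.ae_ne μ p] with w hw₀ hwp
    have hnn (S : Set ℝ) (s : ℝ) (v : W) : 0 ≤ S.indicator (· ^ (-s)) ‖v‖ :=
      Set.indicator_apply_nonneg fun _ => Real.rpow_nonneg (norm_nonneg v) _
    have hnn' (c s : ℝ) (hc : 0 ≤ c) (S : Set ℝ) (t : ℝ) (v : W) :
        0 ≤ c ^ t * S.indicator (· ^ (-s)) ‖v‖ := mul_nonneg (Real.rpow_nonneg hc t) (hnn S s v)
    rw [← ENNReal.ofReal_mul (by positivity), ← ENNReal.ofReal_mul (by positivity),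
      ← ENNReal.ofReal_mul (by positivity), ← ENNReal.ofReal_add (hnn' _ _ hr.le _ _ _)
        (hnn' _ _ hr.le _ _ _), ← ENNReal.ofReal_add
        (add_nonneg (hnn' _ _ hr.le _ _ _) (hnn' _ _ hr.le _ _ _))
        (hnn' _ _ zero_le_three _ _ _)]
    refine ENNReal.ofReal_le_ofReal ?_
    refine rpow_mul_rpow_le_sum_indicator ha₀ hb₀ hr (ρ := ‖w‖) (norm_pos_iff.2 hw₀)
      (norm_pos_iff.2 (sub_ne_zero.2 hwp)) ?_ ?_ ?_
    · have : w - p = W.orthogonalProjectionOnto ((w : E) - y) := by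
        rw [map_sub, Submodule.orthogonalProjectionOnto_mem_subspace_eq_self]
      rw [this]
      exact W.norm_orthogonalProjectionOnto_apply_le _
    · have := norm_sub_le (w : E) ((w : E) - y)
      rw [sub_sub_cancel, Submodule.norm_coe] at this
      linarith
    · have := norm_add_le ((w : E) - y) y
      rw [sub_add_cancel, Submodule.norm_coe] at this
      linarith
  have hmeas (S : Set ℝ) (hS : MeasurableSet S) (s : ℝ) (v : W) : Measurable fun w : W =>
      ENNReal.ofReal (S.indicator (· ^ (-s)) ‖w - v‖) := by
    have : Measurable (S.indicator fun t : ℝ => t ^ (-s)) :=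
      (measurable_id.pow_const _).indicator hS
    exact (this.comp (measurable_norm.comp (measurable_id.sub_const v))).ennreal_ofReal
  have hmeas₀ (S : Set ℝ) (hS : MeasurableSet S) (s : ℝ) : Measurable fun w : W =>
      ENNReal.ofReal (S.indicator (· ^ (-s)) ‖w‖) := by simpa using hmeas S hS s 0
  refine (lintegral_mono_ae hpt).trans_eq ?_
  rw [lintegral_add_right _ ((hmeas₀ _ measurableSet_Ioi _).const_mul _),
    lintegral_add_right _ ((hmeas _ measurableSet_Iic _ _).const_mul _),
    lintegral_const_mul _ (hmeas₀ _ measurableSet_Iic _),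
    lintegral_const_mul _ (hmeas _ measurableSet_Iic _ _),
    lintegral_const_mul _ (hmeas₀ _ measurableSet_Ioi _),
    lintegral_sub_right_eq_self (fun w : W => ENNReal.ofReal
      ((Set.Iic r).indicator (· ^ (-a)) ‖w‖)) p,
    lintegral_indicator_Iic_rpow_norm μ hb hr, lintegral_indicator_Iic_rpow_norm μ ha hr,
    lintegral_indicator_Ioi_rpow_norm μ hab hr, ← hd, ← hV,
    ← ENNReal.ofReal_mul (by positivity), ← ENNReal.ofReal_mul (by positivity),
    ← ENNReal.ofReal_mul (by positivity), ← ENNReal.ofReal_add (by positivity) (by positivity),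
    ← ENNReal.ofReal_add (by positivity) (by positivity)]
  congr 1
  have e₁ : r ^ (d - b) = r ^ a * r ^ (d - a - b) := by
    rw [← Real.rpow_add hr]; ring_nf
  have e₂ : r ^ (d - a) = r ^ b * r ^ (d - a - b) := by
    rw [← Real.rpow_add hr]; ring_nf
  have e₃ : r ^ (d - (a + b)) = (1 / 2) ^ (d - a - b) * ‖y‖ ^ (d - a - b) := by
    rw [hr_def, Real.mul_rpow (by positivity) (by positivity), sub_add_eq_sub_sub]
  have hra : r ^ a ≠ 0 := (Real.rpow_pos_of_pos hr a).ne'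
  have hrb : r ^ b ≠ 0 := (Real.rpow_pos_of_pos hr b).ne'
  rw [e₁, e₂, ← sub_add_eq_sub_sub, e₃, Real.rpow_neg hr.le, Real.rpow_neg hr.le,
    sub_add_eq_sub_sub]
  field_simp

/-- Hausdorff integrals over a subspace of the ambient space are integrals over the subspace. -/
lemma setLIntegral_hausdorffMeasure_submodule {E : Type*} [NormedAddCommGroup E] [NormedSpace ℝ E]
    [MeasurableSpace E] [BorelSpace E] (W : Submodule ℝ E) {s : ℝ} (hs : 0 ≤ s)
    {f : E → ℝ≥0∞} (hf : Measurable f) :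
    ∫⁻ x in (W : Set E), f x ∂μH[s] = ∫⁻ w : W, f w ∂μH[s] := by
  have h := isometry_subtype_coe (s := (W : Set E)).map_hausdorffMeasure (d := s) (Or.inl hs)
  rw [Subtype.range_coe] at h
  rw [← h, lintegral_map hf isometry_subtype_coe.continuous.measurable]
  rfl

/-- `bdryPlane n k` as a linear subspace: the kernel of the `k`-th coordinate. -/
def bdrySubmodule (n : ℕ) (k : Fin n) : Submodule ℝ (EuclideanSpace ℝ (Fin n)) :=
  LinearMap.ker (EuclideanSpace.proj (𝕜 := ℝ) k).toLinearMap

lemma coe_bdrySubmodule (n : ℕ) (k : Fin n) :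
    (bdrySubmodule n k : Set (EuclideanSpace ℝ (Fin n))) = bdryPlane n k := by
  ext x
  simp [bdrySubmodule, bdryPlane]

lemma finrank_bdrySubmodule_add_one (n : ℕ) (k : Fin n) :
    Module.finrank ℝ (bdrySubmodule n k) + 1 = n := by
  have hne : (EuclideanSpace.proj (𝕜 := ℝ) k).toLinearMap ≠
      (0 : EuclideanSpace ℝ (Fin n) →ₗ[ℝ] ℝ) := fun h => by
    simpa using LinearMap.congr_fun h (EuclideanSpace.single k 1)
  rw [bdrySubmodule, Module.Dual.finrank_ker_add_one_of_ne_zero hne, finrank_euclideanSpace_fin]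

/-- for `n ≥ 3` and `2 - n < γ < 0` there is `C = C(n, γ) > 0` such that
`∫_{∂ℝⁿ₊} |x - y|^{2-n} |x|^{γ-1} dσ(x) ≤ C |y|^γ` for every `y ≠ 0`, the boundary
hyperplane carrying its `(n-1)`-dimensional Lebesgue (Hausdorff) measure. -/
theorem stmt_4 (n : ℕ) (hn : 3 ≤ n) (γ : ℝ) (hγ₁ : 2 - (n : ℝ) < γ) (hγ₂ : γ < 0) :
    ∃ C : ℝ, 0 < C ∧
      ∀ y : EuclideanSpace ℝ (Fin n), y ≠ 0 →
        ∫⁻ x in bdryPlane n ⟨n - 1, by omega⟩,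
            ENNReal.ofReal (‖x - y‖ ^ ((2 : ℝ) - n) * ‖x‖ ^ (γ - 1))
            ∂(μH[(n : ℝ) - 1]) ≤
          ENNReal.ofReal (C * ‖y‖ ^ γ) := by
  set W := bdrySubmodule n ⟨n - 1, by omega⟩ with hW
  have hrank : Module.finrank ℝ W + 1 = n := finrank_bdrySubmodule_add_one n _
  have hdim : (Module.finrank ℝ W : ℝ) = n - 1 := by
    rw [eq_sub_iff_add_eq]
    exact_mod_cast hrank
  have hn' : (3 : ℝ) ≤ n := by exact_mod_cast hn
  have : Nontrivial W := Module.nontrivial_of_finrank_pos (R := ℝ) (by omega)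
  obtain ⟨C, hC, h⟩ := exists_lintegral_submodule_rpow_mul_rpow_le W
    (μH[Module.finrank ℝ W]) (a := n - 2) (b := 1 - γ) (by linarith) (by linarith)
    (by linarith) (by linarith) (by linarith)
  refine ⟨C, hC, fun y hy => ?_⟩
  have hy := h y hy
  rw [hdim, neg_sub, neg_sub, show (n : ℝ) - 1 - (n - 2) - (1 - γ) = γ by ring] at hy
  rw [← coe_bdrySubmodule, ← hW, setLIntegral_hausdorffMeasure_submodule W (by linarith)]
  · exact hy
  · fun_prop
end
end

section
/- Let n ≥ 3 and let u be twice continuously differentiable on the exterior region E = {x ∈ ℝⁿ₊ : |x| > 1} of the closed half-space, with Δu = 0 on E, ∂u/∂xₙ = 0 at every point of E with xₙ = 0, and u(x) → 1 as |x| → ∞. Then there exist a real constant C and constants A > 0 and R₀ > 1 such that |u(x) − 1 − C|x|^{2−n}| ≤ A |x|^{1−n} for all x ∈ ℝⁿ₊ with |x| ≥ R₀. -/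
open MeasureTheory Metric Filter
open scoped ENNReal Topology

noncomputable section

/-- The exterior region `{x ∈ ℝⁿ₊ : |x| > 1}` of the closed half-space. -/
def extRegion (n : ℕ) (k : Fin n) : Set (EuclideanSpace ℝ (Fin n)) :=
  {x | 0 ≤ x k ∧ 1 < ‖x‖}

open Set
open scoped RealInnerProductSpace

/-- One-sided second order Taylor expansion at `0`. -/
lemma tendsto_second_order_right {φ φ' : ℝ → ℝ} {a : ℝ}
    (hd : ∀ᶠ t in 𝓝[>] 0, HasDerivAt φ (φ' t) t)
    (hc : Tendsto φ (𝓝[>] 0) (𝓝 (φ 0)))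
    (h2 : HasDerivWithinAt φ' a (Ioi 0) 0) :
    Tendsto (fun t => (φ t - φ 0 - t * φ' 0) / t ^ 2) (𝓝[>] 0) (𝓝 (a / 2)) := by
  have hid : Tendsto (fun t : ℝ => t) (𝓝[>] 0) (𝓝 0) := tendsto_id.mono_left nhdsWithin_le_nhds
  refine HasDerivAt.lhopital_zero_nhdsGT (f' := fun t => φ' t - φ' 0) (g' := fun t => 2 * t)
    ?_ ?_ ?_ ?_ ?_ ?_
  · filter_upwards [hd] with t ht
    exact ((ht.sub_const (φ 0)).sub ((hasDerivAt_id t).mul_const (φ' 0))).congr_deriv (by simp)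
  · exact Eventually.of_forall fun t => by simpa using hasDerivAt_pow 2 t
  · filter_upwards [self_mem_nhdsWithin] with t ht
    have : (0 : ℝ) < t := ht
    positivity
  · simpa using (hc.sub_const (φ 0)).sub (hid.mul_const (φ' 0))
  · simpa using hid.pow 2
  · have h := (hasDerivWithinAt_iff_tendsto_slope' self_notMem_Ioi).1 h2
    refine (h.div_const 2).congr' ?_
    filter_upwards [self_mem_nhdsWithin] with t ht
    have : t ≠ 0 := ne_of_gt ht
    rw [slope_def_field]
    field_simp
    simp

/-- The symmetric second difference quotient at `0` tends to the second derivative. -/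
lemma tendsto_symm_second_difference {φ φ' : ℝ → ℝ} {a : ℝ}
    (hd : ∀ᶠ t in 𝓝 0, HasDerivAt φ (φ' t) t) (h2 : HasDerivAt φ' a 0) :
    Tendsto (fun t => (φ t + φ (-t) - 2 * φ 0) / t ^ 2) (𝓝[>] 0) (𝓝 a) := by
  have hneg : Tendsto (fun t : ℝ => -t) (𝓝 0) (𝓝 0) := by
    simpa using (continuous_neg (G := ℝ)).tendsto 0
  have hc : Tendsto φ (𝓝 0) (𝓝 (φ 0)) := hd.self_of_nhds.continuousAt
  have h₁ := tendsto_second_order_right (hd.filter_mono nhdsWithin_le_nhds)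
    (hc.mono_left nhdsWithin_le_nhds) h2.hasDerivWithinAt
  have h₂ := tendsto_second_order_right (φ := fun t => φ (-t)) (φ' := fun t => -φ' (-t)) (a := a)
    (((hneg.eventually hd).filter_mono nhdsWithin_le_nhds).mono fun t ht => by
      exact (ht.comp t (hasDerivAt_neg t)).congr_deriv (by simp))
    (by rw [neg_zero]; exact (hc.comp hneg).mono_left nhdsWithin_le_nhds)
    (by
      have h := (HasDerivAt.comp (0 : ℝ) (h₂ := φ') (by simpa using h2) (hasDerivAt_neg 0)).neg
      exact (h.congr_deriv (by simp)).hasDerivWithinAt)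
  have h := h₁.add h₂
  rw [add_halves] at h
  refine h.congr fun t => ?_
  simp only [neg_zero]
  ring

/-- `f` has Laplacian `c` at `x` in the sense that, in every orthonormal basis, the sum of the
symmetric second difference quotients of `f` at `x` tends to `c`. -/
def HasSymmLaplacianAt {n : ℕ} (f : EuclideanSpace ℝ (Fin n) → ℝ) (c : ℝ)
    (x : EuclideanSpace ℝ (Fin n)) : Prop :=
  ∀ b : OrthonormalBasis (Fin n) ℝ (EuclideanSpace ℝ (Fin n)),
    Tendsto (fun t : ℝ => ∑ i, (f (x + t • b i) + f (x - t • b i) - 2 * f x) / t ^ 2)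
      (𝓝[>] 0) (𝓝 c)

namespace HasSymmLaplacianAt

variable {n : ℕ} {f g : EuclideanSpace ℝ (Fin n) → ℝ} {c d : ℝ} {x : EuclideanSpace ℝ (Fin n)}

lemma add (hf : HasSymmLaplacianAt f c x) (hg : HasSymmLaplacianAt g d x) :
    HasSymmLaplacianAt (fun y => f y + g y) (c + d) x := fun b => by
  refine ((hf b).add (hg b)).congr fun t => ?_
  rw [← Finset.sum_add_distrib]
  exact Finset.sum_congr rfl fun i _ => by ring

lemma const_mul (hf : HasSymmLaplacianAt f c x) (k : ℝ) :
    HasSymmLaplacianAt (fun y => k * f y) (k * c) x := fun b => by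
  refine ((hf b).const_mul k).congr fun t => ?_
  rw [Finset.mul_sum]
  exact Finset.sum_congr rfl fun i _ => by ring

lemma sub (hf : HasSymmLaplacianAt f c x) (hg : HasSymmLaplacianAt g d x) :
    HasSymmLaplacianAt (fun y => f y - g y) (c - d) x := by
  simpa [sub_eq_add_neg] using hf.add (hg.const_mul (-1))

lemma sub_const (hf : HasSymmLaplacianAt f c x) (k : ℝ) :
    HasSymmLaplacianAt (fun y => f y - k) c x := fun b =>
  (hf b).congr fun t => Finset.sum_congr rfl fun i _ => by ring

lemma comp_isometry (R : EuclideanSpace ℝ (Fin n) ≃ₗᵢ[ℝ] EuclideanSpace ℝ (Fin n))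
    (hf : HasSymmLaplacianAt f c (R x)) : HasSymmLaplacianAt (fun y => f (R y)) c x := fun b => by
  refine (hf (b.map R)).congr fun t => ?_
  simp

lemma nonneg_of_isMin (hf : HasSymmLaplacianAt f c x) (hmin : ∀ᶠ y in 𝓝 x, f x ≤ f y) :
    0 ≤ c := by
  have key : ∀ v : EuclideanSpace ℝ (Fin n), ∀ᶠ t : ℝ in 𝓝[>] 0, f x ≤ f (x + t • v) := by
    intro v
    have hcont : Continuous fun t : ℝ => x + t • v := by fun_prop
    have h : Tendsto (fun t : ℝ => x + t • v) (𝓝 0) (𝓝 x) := by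
      simpa using hcont.tendsto 0
    exact (h.eventually hmin).filter_mono nhdsWithin_le_nhds
  let b := EuclideanSpace.basisFun (Fin n) ℝ
  have h₁ := eventually_all.2 fun i => key (b i)
  have h₂ := eventually_all.2 fun i => key (-b i)
  refine ge_of_tendsto (hf b) ?_
  filter_upwards [h₁, h₂] with t h₁ h₂
  refine Finset.sum_nonneg fun i _ => div_nonneg ?_ (sq_nonneg t)
  have h₁ := h₁ i
  have h₂ := h₂ i
  rw [smul_neg, ← sub_eq_add_neg] at h₂
  linarith

end HasSymmLaplacianAt

lemma hasSymmLaplacianAt_affine_mul_norm_sq_rpow {n : ℕ} (c p : ℝ)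
    (e : EuclideanSpace ℝ (Fin n)) {x : EuclideanSpace ℝ (Fin n)} (hx : x ≠ 0) :
    HasSymmLaplacianAt (fun y => (c + ⟪e, y⟫) * (‖y‖ ^ 2) ^ p)
      (((c + ⟪e, x⟫) * (2 * p * (2 * p - 2 + n)) + 4 * p * ⟪e, x⟫) * (‖x‖ ^ 2) ^ (p - 1)) x := by
  intro b
  have hρ : 0 < ‖x‖ ^ 2 := by positivity
  have key : ∀ i, Tendsto (fun t : ℝ =>
      (((c + ⟪e, x + t • b i⟫) * (‖x + t • b i‖ ^ 2) ^ p)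
        + ((c + ⟪e, x - t • b i⟫) * (‖x - t • b i‖ ^ 2) ^ p)
        - 2 * ((c + ⟪e, x⟫) * (‖x‖ ^ 2) ^ p)) / t ^ 2) (𝓝[>] 0)
      (𝓝 (4 * p * (‖x‖ ^ 2) ^ (p - 1) * (⟪e, b i⟫ * ⟪b i, x⟫) +
        (c + ⟪e, x⟫) * (4 * p * (p - 1) * (‖x‖ ^ 2) ^ (p - 1 - 1) * ‖⟪b i, x⟫‖ ^ 2
          + 2 * p * (‖x‖ ^ 2) ^ (p - 1)))) := by
    intro i
    set β := ⟪b i, x⟫ with hβ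
    set ε := ⟪e, b i⟫ with hε
    set γ := ⟪e, x⟫ with hγ
    set ρ := ‖x‖ ^ 2 with hρdef
    have hn : ∀ t : ℝ, ‖x + t • b i‖ ^ 2 = ρ + 2 * t * β + t ^ 2 := by
      intro t
      rw [norm_add_sq_real, inner_smul_right, norm_smul, b.norm_eq_one, real_inner_comm]
      simp
      ring
    have hi : ∀ t : ℝ, ⟪e, x + t • b i⟫ = γ + t * ε := by
      intro t
      rw [inner_add_right, inner_smul_right]
    have hpos : ∀ᶠ t : ℝ in 𝓝 0, 0 < ρ + 2 * t * β + t ^ 2 := by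
      have hcont : Continuous fun t : ℝ => ρ + 2 * t * β + t ^ 2 := by fun_prop
      exact hcont.continuousAt.eventually (lt_mem_nhds (by simpa using hρ))
    have hq : ∀ t : ℝ, HasDerivAt (fun t : ℝ => ρ + 2 * t * β + t ^ 2) (2 * β + 2 * t) t := by
      intro t
      have h := (((hasDerivAt_id t).const_mul 2).mul_const β).const_add ρ |>.add (hasDerivAt_pow 2 t)
      exact h.congr_deriv (by simp)
    have hl : ∀ t : ℝ, HasDerivAt (fun t : ℝ => c + (γ + t * ε)) ε t := by
      intro t
      simpa using (((hasDerivAt_id t).mul_const ε).const_add γ).const_add c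
    have hr : ∀ (q t : ℝ), 0 < ρ + 2 * t * β + t ^ 2 →
        HasDerivAt (fun t : ℝ => (ρ + 2 * t * β + t ^ 2) ^ q)
          ((2 * β + 2 * t) * q * (ρ + 2 * t * β + t ^ 2) ^ (q - 1)) t := fun q t ht =>
      (hq t).rpow_const (Or.inl ht.ne')
    have hr0 := fun q => hr q 0 (by simpa using hρ)
    have hl2 : HasDerivAt (fun t : ℝ => (2 * β + 2 * t) * p) (2 * p) 0 := by
      simpa using (((hasDerivAt_id (0 : ℝ)).const_mul 2).const_add (2 * β)).mul_const p
    have h := tendsto_symm_second_difference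
      (hpos.mono fun t ht => (hl t).mul (hr p t ht))
      (((hr0 p).const_mul ε).add ((hl 0).mul (hl2.mul (hr0 (p - 1)))))
    convert! h using 1
    · funext t
      simp only [sub_eq_add_neg, ← neg_smul, hn, hi]
      simp
    · simp
      ring
  convert! tendsto_finsetSum Finset.univ fun i _ => key i using 1
  · congr 1
    have hp : (‖x‖ ^ 2) ^ (p - 1) = (‖x‖ ^ 2) ^ (p - 1 - 1) * ‖x‖ ^ 2 := by
      rw [← Real.rpow_add_one hρ.ne']
      ring_nf
    rw [Finset.sum_add_distrib, ← Finset.mul_sum, ← Finset.mul_sum, Finset.sum_add_distrib,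
      ← Finset.mul_sum, b.sum_inner_mul_inner, b.sum_sq_norm_inner_right, Finset.sum_const, hp]
    simp
    ring

/-- Minimum principle on a closed set avoiding the origin, for functions vanishing at infinity. -/
lemma nonneg_of_symmLaplacian_nonpos {n : ℕ} (hn : 3 ≤ n) {K : Set (EuclideanSpace ℝ (Fin n))}
    (hK : IsClosed K) (h0 : (0 : EuclideanSpace ℝ (Fin n)) ∉ K)
    {f : EuclideanSpace ℝ (Fin n) → ℝ} (hf : ContinuousOn f K)
    (hfK : ∀ x ∈ K, 0 ≤ f x ∨ (x ∈ interior K ∧ HasSymmLaplacianAt f 0 x))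
    (hlim : ∀ ε : ℝ, 0 < ε → ∃ R : ℝ, ∀ x ∈ K, R ≤ ‖x‖ → -ε < f x) :
    ∀ x ∈ K, 0 ≤ f x := by
  intro x₁ hx₁
  by_contra! hneg
  have hne : ∀ x ∈ K, x ≠ 0 := fun x hx h => h0 (h ▸ hx)
  let g : EuclideanSpace ℝ (Fin n) → ℝ := fun y =>
    (1 + ⟪(0 : EuclideanSpace ℝ (Fin n)), y⟫) * (‖y‖ ^ 2) ^ (-1 / 4 : ℝ)
  have hgpos : ∀ x ∈ K, 0 < g x := by
    intro x hx
    have := hne x hx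
    simp only [g, inner_zero_left, add_zero, one_mul]
    positivity
  have hgc : ContinuousOn g K := by
    refine ContinuousOn.mul (by fun_prop) (ContinuousOn.rpow_const (by fun_prop) fun x hx => ?_)
    have := hne x hx
    left; positivity
  obtain ⟨δ, hδ, hδ₁⟩ : ∃ δ > 0, f x₁ + δ * g x₁ < 0 := by
    refine ⟨-f x₁ / (2 * g x₁), by have := hgpos x₁ hx₁; apply div_pos <;> linarith, ?_⟩
    have := hgpos x₁ hx₁
    field_simp
    linarith
  obtain ⟨R, hR⟩ := hlim (-(f x₁ + δ * g x₁)) (by linarith)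
  have hx₁R : ‖x₁‖ < R := by
    by_contra! h
    have h₁ := hR x₁ hx₁ h
    have h₂ := mul_pos hδ (hgpos x₁ hx₁)
    linarith
  have hcomp : IsCompact (K ∩ closedBall 0 R) := (isCompact_closedBall 0 R).inter_left hK
  have hcont : ContinuousOn (fun y => f y + δ * g y) (K ∩ closedBall 0 R) :=
    (hf.add (continuousOn_const.mul hgc)).mono inter_subset_left
  obtain ⟨x₀, ⟨hx₀K, hx₀R⟩, hmin⟩ := hcomp.exists_isMinOn
    ⟨x₁, hx₁, by simpa using hx₁R.le⟩ hcont
  have hx₀₁ : f x₀ + δ * g x₀ ≤ f x₁ + δ * g x₁ := hmin ⟨hx₁, by simpa using hx₁R.le⟩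
  have hminK : ∀ y ∈ K, f x₀ + δ * g x₀ ≤ f y + δ * g y := by
    intro y hy
    rcases le_total ‖y‖ R with h | h
    · exact hmin ⟨hy, by simpa using h⟩
    · have h₁ := hR y hy h
      have h₂ := mul_pos hδ (hgpos y hy)
      linarith
  rcases hfK x₀ hx₀K with h | ⟨hint, hlap⟩
  · have h₂ := mul_pos hδ (hgpos x₀ hx₀K)
    linarith
  · have hg := hasSymmLaplacianAt_affine_mul_norm_sq_rpow 1 (-1 / 4 : ℝ) 0 (hne x₀ hx₀K)
    have h := (hlap.add (hg.const_mul δ)).nonneg_of_isMin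
      (by filter_upwards [mem_interior_iff_mem_nhds.1 hint] with y hy using hminK y hy)
    have hx₀ := hne x₀ hx₀K
    have hn' : (3 : ℝ) ≤ n := by exact_mod_cast hn
    have hP : 0 < δ * (‖x₀‖ ^ 2) ^ (-1 / 4 - 1 : ℝ) := by positivity
    simp only [inner_zero_left] at h
    nlinarith

section Exterior

variable {n : ℕ} {w : EuclideanSpace ℝ (Fin n) → ℝ}

/-- A function harmonic outside the unit ball and vanishing at infinity which is dominated by a
multiple of the fundamental solution on a sphere is dominated by it outside that sphere. -/
lemma le_fundamental_of_le_on_sphere (hn : 3 ≤ n)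
    (hw : ContinuousOn w {x | 1 < ‖x‖})
    (hlap : ∀ x, 1 < ‖x‖ → HasSymmLaplacianAt w 0 x)
    (hlim : ∀ ε : ℝ, 0 < ε → ∃ R : ℝ, ∀ x, R ≤ ‖x‖ → |w x| < ε)
    {r c : ℝ} (hr : 1 < r) (hc : ∀ x, ‖x‖ = r → w x ≤ c * (‖x‖ ^ 2) ^ ((2 - n : ℝ) / 2))
    {x : EuclideanSpace ℝ (Fin n)} (hx : r ≤ ‖x‖) :
    w x ≤ c * (‖x‖ ^ 2) ^ ((2 - n : ℝ) / 2) := by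
  have hlimG := tendsto_rpow_neg_atTop (y := (n - 2 : ℝ) / 2)
    (by have : (3 : ℝ) ≤ n := by exact_mod_cast hn
        linarith)
  have hK : IsClosed {y : EuclideanSpace ℝ (Fin n) | r ≤ ‖y‖} :=
    isClosed_le continuous_const continuous_norm
  have hO : IsOpen {y : EuclideanSpace ℝ (Fin n) | r < ‖y‖} :=
    isOpen_lt continuous_const continuous_norm
  have hne : ∀ y : EuclideanSpace ℝ (Fin n), r ≤ ‖y‖ → y ≠ 0 := fun y hy => by
    rw [← norm_pos_iff]; linarith
  have key := nonneg_of_symmLaplacian_nonpos hn hK (by simp; linarith)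
    (f := fun y => c * ((1 + ⟪(0 : EuclideanSpace ℝ (Fin n)), y⟫) *
      (‖y‖ ^ 2) ^ ((2 - n : ℝ) / 2)) - w y) ?_ ?_ ?_ x hx
  · simpa using key
  · refine ContinuousOn.sub (continuousOn_const.mul (ContinuousOn.mul (by fun_prop)
      (ContinuousOn.rpow_const (by fun_prop) fun y hy => ?_)))
      (hw.mono fun y hy => lt_of_lt_of_le hr hy)
    have := hne y hy
    left; positivity
  · intro y hy
    rcases eq_or_lt_of_le (show r ≤ ‖y‖ from hy) with h | h
    · left
      simpa using hc y h.symm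
    · right
      refine ⟨mem_interior.2 ⟨{z | r < ‖z‖}, fun z (hz : r < ‖z‖) => hz.le, hO, h⟩, ?_⟩
      have h := ((hasSymmLaplacianAt_affine_mul_norm_sq_rpow 1 ((2 - n : ℝ) / 2) 0
        (hne y hy)).const_mul c).sub (hlap y (lt_of_lt_of_le hr hy))
      convert! h using 1
      simp only [inner_zero_left]
      ring
  · intro ε hε
    obtain ⟨R₁, hR₁⟩ := hlim (ε / 2) (by positivity)
    have hG : ∀ᶠ t : ℝ in atTop, |c * t ^ (-((n - 2 : ℝ) / 2))| < ε / 2 := by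
      have h := (hlimG.const_mul c).abs
      rw [mul_zero, abs_zero] at h
      exact h.eventually (gt_mem_nhds (by positivity))
    obtain ⟨R₂, hR₂⟩ := eventually_atTop.1 hG
    refine ⟨max R₁ (max R₂ 1), fun y _ hyR => ?_⟩
    simp only [max_le_iff] at hyR
    obtain ⟨h₁, h₂, h₃⟩ := hyR
    have h₁ := hR₁ y h₁
    have h₂ := hR₂ (‖y‖ ^ 2) (by nlinarith)
    rw [show -((n - 2 : ℝ) / 2) = (2 - n) / 2 by ring] at h₂
    have h₁ := abs_lt.1 h₁
    have h₂ := abs_lt.1 h₂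
    simp only [inner_zero_left, add_zero, one_mul]
    linarith

lemma reflection_orthogonal_singleton_eq (e x : EuclideanSpace ℝ (Fin n)) :
    (ℝ ∙ e)ᗮ.reflection x = x - (2 * (⟪e, x⟫ / ‖e‖ ^ 2)) • e := by
  rw [Submodule.reflection_orthogonal_apply, Submodule.reflection_singleton_apply, two_smul,
    mul_smul, two_smul]
  simp

/-- Comparison of a decaying exterior harmonic function with its reflection in a hyperplane,
by means of the harmonic barrier `⟪e, x⟫ * ‖x‖ ^ (-n)`. -/
lemma sub_reflection_le (hn : 3 ≤ n)
    (hw : ContinuousOn w {x | 1 < ‖x‖})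
    (hlap : ∀ x, 1 < ‖x‖ → HasSymmLaplacianAt w 0 x)
    (hlim : ∀ ε : ℝ, 0 < ε → ∃ R : ℝ, ∀ x, R ≤ ‖x‖ → |w x| < ε)
    {L : ℝ} (hL : 0 ≤ L) (hLip : ∀ x y, ‖x‖ = 2 → ‖y‖ = 2 → |w x - w y| ≤ L * ‖x - y‖)
    {e x : EuclideanSpace ℝ (Fin n)} (he : ‖e‖ = 1) (hx : 2 ≤ ‖x‖) (hex : 0 ≤ ⟪e, x⟫) :
    w x - w ((ℝ ∙ e)ᗮ.reflection x) ≤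
      2 * L * (4 ^ ((n : ℝ) / 2)) * (⟪e, x⟫ * (‖x‖ ^ 2) ^ (-(n : ℝ) / 2)) := by
  set R := (ℝ ∙ e)ᗮ.reflection with hRdef
  have hRx : ∀ y, R y = y - (2 * ⟪e, y⟫) • e := fun y => by
    rw [hRdef, reflection_orthogonal_singleton_eq, he]; simp
  have hK : IsClosed {y : EuclideanSpace ℝ (Fin n) | 2 ≤ ‖y‖ ∧ 0 ≤ ⟪e, y⟫} := by
    rw [ofPred_and]
    exact (isClosed_le continuous_const continuous_norm).inter
      (isClosed_le continuous_const (continuous_const.inner continuous_id))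
  have hO : IsOpen {y : EuclideanSpace ℝ (Fin n) | 2 < ‖y‖ ∧ 0 < ⟪e, y⟫} := by
    rw [ofPred_and]
    exact (isOpen_lt continuous_const continuous_norm).inter
      (isOpen_lt continuous_const (continuous_const.inner continuous_id))
  have hne : ∀ y : EuclideanSpace ℝ (Fin n), 2 ≤ ‖y‖ → y ≠ 0 := fun y hy => by
    rw [← norm_pos_iff]; linarith
  have hmaps : MapsTo R {y : EuclideanSpace ℝ (Fin n) | 2 ≤ ‖y‖ ∧ 0 ≤ ⟪e, y⟫} {y | 1 < ‖y‖} := by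
    intro y hy
    have := hy.1
    simp only [mem_ofPred_eq, LinearIsometryEquiv.norm_map]
    linarith
  have key := nonneg_of_symmLaplacian_nonpos hn hK (by simp)
    (f := fun y => 2 * L * (4 ^ ((n : ℝ) / 2)) * ((0 + ⟪e, y⟫) * (‖y‖ ^ 2) ^ (-(n : ℝ) / 2))
      - (w y - w (R y))) ?_ ?_ ?_ x ⟨hx, hex⟩
  · simpa using key
  · refine ContinuousOn.sub (continuousOn_const.mul (ContinuousOn.mul (by fun_prop)
      (ContinuousOn.rpow_const (by fun_prop) fun y hy => ?_)))
      ((hw.mono fun y hy => lt_of_lt_of_le one_lt_two hy.1).sub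
        (hw.comp R.continuous.continuousOn hmaps))
    have := hne y hy.1
    left; positivity
  · rintro y ⟨hy, hey⟩
    rcases eq_or_lt_of_le hey with h | h
    · left
      simp [hRx, ← h]
    rcases eq_or_lt_of_le hy with h' | h'
    · left
      have h₁ := hLip y (R y) h'.symm (by rw [R.norm_map, h'])
      have h₂ : ‖y - R y‖ = 2 * ⟪e, y⟫ := by
        rw [hRx, sub_sub_cancel, norm_smul, he, Real.norm_of_nonneg (by positivity), mul_one]
      have h₃ : (4 : ℝ) ^ ((n : ℝ) / 2) * (‖y‖ ^ 2) ^ (-(n : ℝ) / 2) = 1 := by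
        rw [← h', neg_div, Real.rpow_neg (by positivity), show (2 : ℝ) ^ 2 = 4 by norm_num]
        exact mul_inv_cancel₀ (by positivity)
      rw [h₂] at h₁
      have h₄ := (abs_le.1 h₁).2
      have h₅ : 2 * L * (4 ^ ((n : ℝ) / 2)) * ((0 + ⟪e, y⟫) * (‖y‖ ^ 2) ^ (-(n : ℝ) / 2))
          = L * (2 * ⟪e, y⟫) * (4 ^ ((n : ℝ) / 2) * (‖y‖ ^ 2) ^ (-(n : ℝ) / 2)) := by ring
      simp only [h₅, h₃]
      linarith
    · right
      refine ⟨mem_interior.2 ⟨{z | 2 < ‖z‖ ∧ 0 < ⟪e, z⟫}, fun z hz => ⟨hz.1.le, hz.2.le⟩, hO,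
        ⟨h', h⟩⟩, ?_⟩
      have h := ((hasSymmLaplacianAt_affine_mul_norm_sq_rpow 0 (-(n : ℝ) / 2) e
        (hne y hy)).const_mul (2 * L * (4 ^ ((n : ℝ) / 2)))).sub
        ((hlap y (by linarith)).sub
          ((hlap (R y) (by rw [R.norm_map]; linarith)).comp_isometry R))
      convert! h using 1
      ring
  · intro ε hε
    obtain ⟨R₁, hR₁⟩ := hlim (ε / 2) (by positivity)
    refine ⟨R₁, fun y hy hyR => ?_⟩
    have h₁ := abs_lt.1 (hR₁ y hyR)
    have h₂ := abs_lt.1 (hR₁ (R y) (by rwa [R.norm_map]))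
    have h₃ : 0 ≤ 2 * L * (4 ^ ((n : ℝ) / 2)) *
        ((0 + ⟪e, y⟫) * (‖y‖ ^ 2) ^ (-(n : ℝ) / 2)) := by
      have := hy.2
      rw [zero_add]
      positivity
    linarith

/-- The oscillation over spheres of a decaying exterior harmonic function. -/
lemma exists_oscillation_bound (hn : 3 ≤ n)
    (hw : LocallyLipschitzOn {x | 1 < ‖x‖} w)
    (hlap : ∀ x, 1 < ‖x‖ → HasSymmLaplacianAt w 0 x)
    (hlim : ∀ ε : ℝ, 0 < ε → ∃ R : ℝ, ∀ x, R ≤ ‖x‖ → |w x| < ε) :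
    ∃ A : ℝ, 0 < A ∧ ∀ x y, 2 ≤ ‖x‖ → ‖y‖ = ‖x‖ →
      w x - w y ≤ A / ‖x‖ * (‖x‖ ^ 2) ^ ((2 - n : ℝ) / 2) := by
  obtain ⟨L, hL⟩ := (hw.mono (s := sphere (0 : EuclideanSpace ℝ (Fin n)) 2)
    fun x hx => by simp_all).exists_lipschitzOnWith_of_compact (isCompact_sphere 0 2)
  have hLip : ∀ x y, ‖x‖ = 2 → ‖y‖ = 2 → |w x - w y| ≤ L * ‖x - y‖ := fun x y hx hy => by
    simpa [Real.dist_eq, dist_eq_norm] using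
      hL.dist_le_mul x (by simpa using hx) y (by simpa using hy)
  refine ⟨2 * L * 4 ^ ((n : ℝ) / 2) + 1, by positivity, fun x y hx hxy => ?_⟩
  have hxpos : 0 < ‖x‖ := by linarith
  rcases eq_or_ne x y with rfl | hne
  · rw [sub_self]; positivity
  have hne' : x - y ≠ 0 := sub_ne_zero.2 hne
  let e := ‖x - y‖⁻¹ • (x - y)
  have he : ‖e‖ = 1 := norm_smul_inv_norm hne'
  have hex : 0 ≤ ⟪e, x⟫ := by
    rw [inner_smul_left, inner_sub_left, real_inner_self_eq_norm_sq]
    have := real_inner_le_norm y x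
    rw [hxy] at this
    refine mul_nonneg (by simp) (by nlinarith)
  have hspan : (ℝ ∙ e) = ℝ ∙ (x - y) :=
    Submodule.span_singleton_smul_eq (IsUnit.mk0 _ (inv_ne_zero (norm_ne_zero_iff.2 hne'))) _
  have hR : (ℝ ∙ e)ᗮ.reflection x = y := by
    simp only [hspan]
    exact Submodule.reflection_sub hxy.symm
  have h := sub_reflection_le hn hw.continuousOn hlap hlim L.2 hLip he hx hex
  rw [hR] at h
  refine h.trans ?_
  have hpow : ‖x‖ * (‖x‖ ^ 2) ^ (-(n : ℝ) / 2) = 1 / ‖x‖ * (‖x‖ ^ 2) ^ ((2 - n : ℝ) / 2) := by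
    rw [show (2 - n : ℝ) / 2 = -(n : ℝ) / 2 + 1 by ring, Real.rpow_add_one (by positivity)]
    field_simp
  have hle : ⟪e, x⟫ ≤ ‖x‖ := by simpa [he] using real_inner_le_norm e x
  have hG : 0 ≤ 1 / ‖x‖ * (‖x‖ ^ 2) ^ ((2 - n : ℝ) / 2) := by positivity
  have hcoe : (L.1 : ℝ) = L := rfl
  calc 2 * L.1 * (4 ^ ((n : ℝ) / 2)) * (⟪e, x⟫ * (‖x‖ ^ 2) ^ (-(n : ℝ) / 2))
      ≤ 2 * L * (4 ^ ((n : ℝ) / 2)) * (‖x‖ * (‖x‖ ^ 2) ^ (-(n : ℝ) / 2)) := by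
        rw [hcoe]; gcongr
    _ = 2 * L * (4 ^ ((n : ℝ) / 2)) * (1 / ‖x‖ * (‖x‖ ^ 2) ^ ((2 - n : ℝ) / 2)) := by rw [hpow]
    _ ≤ (2 * L * (4 ^ ((n : ℝ) / 2)) + 1) * (1 / ‖x‖ * (‖x‖ ^ 2) ^ ((2 - n : ℝ) / 2)) := by
        linarith
    _ = _ := by ring

/-- The leading term at infinity of a decaying exterior harmonic function. -/
lemma exists_exterior_expansion (hn : 3 ≤ n)
    (hw : LocallyLipschitzOn {x | 1 < ‖x‖} w)
    (hlap : ∀ x, 1 < ‖x‖ → HasSymmLaplacianAt w 0 x)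
    (hlim : ∀ ε : ℝ, 0 < ε → ∃ R : ℝ, ∀ x, R ≤ ‖x‖ → |w x| < ε) :
    ∃ C A : ℝ, 0 < A ∧ ∀ x, 2 ≤ ‖x‖ →
      |w x - C * ‖x‖ ^ (2 - n : ℝ)| ≤ A * ‖x‖ ^ (1 - n : ℝ) := by
  obtain ⟨A, hA, hosc⟩ := exists_oscillation_bound hn hw hlap hlim
  let G : EuclideanSpace ℝ (Fin n) → ℝ := fun x => (‖x‖ ^ 2) ^ ((2 - n : ℝ) / 2)
  have hGpos : ∀ x, 2 ≤ ‖x‖ → 0 < G x := fun x hx => by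
    have : 0 < ‖x‖ := by linarith
    positivity
  have hmono : ∀ x y, 2 ≤ ‖x‖ → ‖x‖ ≤ ‖y‖ → |w y / G y - w x / G x| ≤ A / ‖x‖ := by
    intro x y hx hxy
    have hGx := hGpos x hx
    have hGy := hGpos y (hx.trans hxy)
    have hwx : w x / G x * G x = w x := div_mul_cancel₀ _ hGx.ne'
    have hup := le_fundamental_of_le_on_sphere hn hw.continuousOn hlap hlim
      (c := w x / G x + A / ‖x‖) (by linarith : 1 < ‖x‖) (fun z hz => by
        have h := hosc z x (hz ▸ hx) hz.symm
        rw [hz] at h ⊢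
        change _ ≤ _ * G x
        rw [add_mul, hwx]
        linarith) hxy
    have hlow := le_fundamental_of_le_on_sphere (w := fun z => -1 * w z) hn
      (continuousOn_const.mul hw.continuousOn)
      (fun z hz => by simpa using (hlap z hz).const_mul (-1))
      (fun ε hε => by simpa using hlim ε hε)
      (c := -(w x / G x) + A / ‖x‖) (by linarith : 1 < ‖x‖) (fun z hz => by
        have h := hosc x z hx hz
        rw [hz]
        change _ ≤ _ * G x
        rw [add_mul, neg_mul (w x / G x), hwx]
        change _ ≤ _ * G x at h
        linarith) hxy
    change _ ≤ _ * G y at hup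
    change _ ≤ _ * G y at hlow
    rw [← div_le_iff₀ hGy] at hup hlow
    rw [neg_one_mul, neg_div] at hlow
    exact abs_le.2 ⟨by linarith, by linarith⟩
  let e : EuclideanSpace ℝ (Fin n) := EuclideanSpace.single ⟨0, by omega⟩ 1
  let z : ℕ → EuclideanSpace ℝ (Fin n) := fun m => ((m : ℝ) + 2) • e
  have hz : ∀ m, ‖z m‖ = m + 2 := fun m => by
    simp only [z, e, norm_smul, PiLp.norm_single, norm_one, mul_one]
    exact Real.norm_of_nonneg (by positivity)
  have hz2 : ∀ m, 2 ≤ ‖z m‖ := fun m => by rw [hz]; linarith [(Nat.cast_nonneg m : (0 : ℝ) ≤ m)]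
  have hcauchy : CauchySeq fun m => w (z m) / G (z m) := by
    refine cauchySeq_of_le_tendsto_0' (fun m : ℕ => A / ((m : ℝ) + 2)) (fun m k hmk => ?_) ?_
    · rw [dist_comm, Real.dist_eq, ← hz]
      refine hmono _ _ (hz2 m) ?_
      rw [hz, hz]
      have : (m : ℝ) ≤ k := by exact_mod_cast hmk
      linarith
    · exact tendsto_const_nhds.div_atTop
        (tendsto_atTop_add_const_right _ _ tendsto_natCast_atTop_atTop)
  obtain ⟨C, hC⟩ := cauchySeq_tendsto_of_complete hcauchy
  refine ⟨C, A, hA, fun x hx => ?_⟩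
  have hxpos : 0 < ‖x‖ := by linarith
  have hlimx : |C - w x / G x| ≤ A / ‖x‖ := by
    refine le_of_tendsto (hC.sub_const _).abs ?_
    filter_upwards [eventually_ge_atTop ⌈‖x‖⌉₊] with m hm
    refine hmono x (z m) hx ?_
    rw [hz]
    have := Nat.ceil_le.1 hm
    linarith
  have hGx := hGpos x hx
  have hG : ‖x‖ ^ (2 - n : ℝ) = G x := by
    simp only [G]
    rw [← Real.rpow_natCast_mul hxpos.le]
    congr 1
    push_cast
    ring
  have hG' : ‖x‖ ^ (1 - n : ℝ) = G x / ‖x‖ := by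
    rw [← hG, ← Real.rpow_sub_one hxpos.ne']
    ring_nf
  have hfac : w x - C * G x = -(C - w x / G x) * G x := by
    field_simp
    ring
  rw [hG, hG', hfac, abs_mul, abs_neg, abs_of_pos hGx]
  calc |C - w x / G x| * G x ≤ A / ‖x‖ * G x := by gcongr
    _ = A * (G x / ‖x‖) := by ring

end Exterior

section HalfSpace

variable {n : ℕ} {k : Fin n} {u : EuclideanSpace ℝ (Fin n) → ℝ}

lemma uniqueDiffOn_extRegion (n : ℕ) (k : Fin n) : UniqueDiffOn ℝ (extRegion n k) := by
  have hlin : Convex ℝ {x : EuclideanSpace ℝ (Fin n) | 0 ≤ x k} :=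
    convex_halfSpace_ge (EuclideanSpace.proj (𝕜 := ℝ) k).isLinear 0
  refine (uniqueDiffOn_convex hlin ⟨EuclideanSpace.single k 1, ?_⟩).inter
    (isOpen_lt continuous_const continuous_norm)
  have hO : IsOpen {x : EuclideanSpace ℝ (Fin n) | 0 < x k} :=
    isOpen_lt continuous_const (EuclideanSpace.proj (𝕜 := ℝ) k).continuous
  exact mem_interior.2 ⟨{x | 0 < x k}, fun x (hx : 0 < x k) => hx.le, hO, by simp⟩

/-- Second order Taylor expansion along a ray staying in `S`. -/
lemma tendsto_taylor_along_ray {S : Set (EuclideanSpace ℝ (Fin n))} (hS : UniqueDiffOn ℝ S)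
    (hu : ContDiffOn ℝ 2 u S) {x : EuclideanSpace ℝ (Fin n)} (hx : x ∈ S)
    {v : EuclideanSpace ℝ (Fin n)} (hv : ∀ᶠ t : ℝ in 𝓝[>] 0, x + t • v ∈ S) :
    Tendsto (fun t : ℝ => (u (x + t • v) - u x - t * fderivWithin ℝ u S x v) / t ^ 2) (𝓝[>] 0)
      (𝓝 (iteratedFDerivWithin ℝ 2 u S x ![v, v] / 2)) := by
  obtain ⟨δ, hδ, hsub⟩ := mem_nhdsGT_iff_exists_Ioo_subset.1 hv
  have hδ : (0 : ℝ) < δ := hδ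
  have hmaps : MapsTo (fun t : ℝ => x + t • v) (Ioo 0 δ) S := fun t ht => hsub ht
  have hline : ∀ t : ℝ, HasDerivWithinAt (fun t : ℝ => x + t • v) v (Ioo 0 δ) t := fun t => by
    simpa using (((hasDerivAt_id t).smul_const v).const_add x).hasDerivWithinAt
  have hIoo : Ioo 0 δ ∈ 𝓝[>] (0 : ℝ) := Ioo_mem_nhdsGT hδ
  have hdu : DifferentiableOn ℝ u S := hu.differentiableOn two_ne_zero
  have hdu' : DifferentiableOn ℝ (fderivWithin ℝ u S) S :=
    (hu.fderivWithin hS (m := 1) (by norm_num)).differentiableOn one_ne_zero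
  have h := tendsto_second_order_right (φ := fun t => u (x + t • v))
    (φ' := fun t => fderivWithin ℝ u S (x + t • v) v)
    (a := fderivWithin ℝ (fderivWithin ℝ u S) S x v v) ?_ ?_ ?_
  · rw [iteratedFDerivWithin_two_apply u hS hx]
    simpa using h
  · filter_upwards [hIoo] with t ht
    exact ((hdu _ (hmaps ht)).hasFDerivWithinAt.comp_hasDerivWithinAt t (hline t) hmaps).hasDerivAt
      (Ioo_mem_nhds ht.1 ht.2)
  · have hc := (hdu x hx).continuousWithinAt
    have hl : Tendsto (fun t : ℝ => x + t • v) (𝓝[>] 0) (𝓝[S] x) := by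
      refine tendsto_nhdsWithin_iff.2 ⟨?_, hv⟩
      have hcont : Continuous fun t : ℝ => x + t • v := by fun_prop
      simpa using (hcont.tendsto 0).mono_left nhdsWithin_le_nhds
    simpa using! hc.tendsto.comp hl
  · have h₁ : HasFDerivWithinAt (fderivWithin ℝ u S)
        (fderivWithin ℝ (fderivWithin ℝ u S) S x) S (x + (0 : ℝ) • v) := by
      simpa using (hdu' x hx).hasFDerivWithinAt
    have h₂ : HasDerivWithinAt (fun t : ℝ => fderivWithin ℝ u S (x + t • v))
        (fderivWithin ℝ (fderivWithin ℝ u S) S x v) (Ioo 0 δ) 0 :=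
      HasFDerivWithinAt.comp_hasDerivWithinAt (f := fun t : ℝ => x + t • v) (0 : ℝ) h₁
        (hline 0) hmaps
    have h₃ := h₂.clm_apply (hasDerivWithinAt_const (0 : ℝ) (Ioo 0 δ) v)
    exact (h₃.congr_deriv (by simp)).mono_of_mem_nhdsWithin hIoo

/-- Second difference quotients of a function given along two opposite rays by `u` along rays
with cancelling first derivatives. -/
lemma tendsto_second_difference_of_rays {S : Set (EuclideanSpace ℝ (Fin n))}
    (hS : UniqueDiffOn ℝ S) (hu : ContDiffOn ℝ 2 u S) {x : EuclideanSpace ℝ (Fin n)} (hx : x ∈ S)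
    {w : EuclideanSpace ℝ (Fin n) → ℝ} {b v₁ v₂ : EuclideanSpace ℝ (Fin n)} (hw : w x = u x)
    (h₁ : ∀ᶠ t : ℝ in 𝓝[>] 0, x + t • v₁ ∈ S ∧ w (x + t • b) = u (x + t • v₁))
    (h₂ : ∀ᶠ t : ℝ in 𝓝[>] 0, x + t • v₂ ∈ S ∧ w (x - t • b) = u (x + t • v₂))
    (hcancel : fderivWithin ℝ u S x v₁ + fderivWithin ℝ u S x v₂ = 0) :
    Tendsto (fun t : ℝ => (w (x + t • b) + w (x - t • b) - 2 * w x) / t ^ 2) (𝓝[>] 0)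
      (𝓝 ((iteratedFDerivWithin ℝ 2 u S x ![v₁, v₁] +
        iteratedFDerivWithin ℝ 2 u S x ![v₂, v₂]) / 2)) := by
  have h := (tendsto_taylor_along_ray hS hu hx (h₁.mono fun t ht => ht.1)).add
    (tendsto_taylor_along_ray hS hu hx (h₂.mono fun t ht => ht.1))
  rw [← add_div] at h
  refine h.congr' ?_
  filter_upwards [h₁, h₂] with t h₁ h₂
  rw [h₁.2, h₂.2, hw, ← add_div]
  congr 1
  linear_combination (-t) * hcancel

/-- The folding of space onto the half-space `0 ≤ x k`. -/
def foldHalfSpace (k : Fin n) (x : EuclideanSpace ℝ (Fin n)) : EuclideanSpace ℝ (Fin n) :=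
  x + (|x k| - x k) • EuclideanSpace.single k 1

/-- The reflection in the hyperplane `x k = 0`. -/
def coordReflection (k : Fin n) : EuclideanSpace ℝ (Fin n) ≃ₗᵢ[ℝ] EuclideanSpace ℝ (Fin n) :=
  (ℝ ∙ (EuclideanSpace.single k (1 : ℝ)))ᗮ.reflection

lemma coordReflection_eq (x : EuclideanSpace ℝ (Fin n)) :
    coordReflection k x = x - (2 * x k) • EuclideanSpace.single k 1 := by
  simp [coordReflection, reflection_orthogonal_singleton_eq, EuclideanSpace.inner_single_left]

lemma coordReflection_apply_self (x : EuclideanSpace ℝ (Fin n)) :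
    coordReflection k x k = -x k := by
  rw [coordReflection_eq]
  simp
  ring

lemma foldHalfSpace_of_nonneg {x : EuclideanSpace ℝ (Fin n)} (hx : 0 ≤ x k) :
    foldHalfSpace k x = x := by
  simp [foldHalfSpace, abs_of_nonneg hx]

lemma foldHalfSpace_of_nonpos {x : EuclideanSpace ℝ (Fin n)} (hx : x k ≤ 0) :
    foldHalfSpace k x = coordReflection k x := by
  rw [foldHalfSpace, coordReflection_eq, abs_of_nonpos hx]
  module

lemma foldHalfSpace_coordReflection (x : EuclideanSpace ℝ (Fin n)) :
    foldHalfSpace k (coordReflection k x) = foldHalfSpace k x := by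
  rcases le_total 0 (x k) with h | h
  · rw [foldHalfSpace_of_nonneg h,
      foldHalfSpace_of_nonpos (by rw [coordReflection_apply_self]; linarith)]
    exact Submodule.reflection_reflection _ x
  · rw [foldHalfSpace_of_nonpos h,
      foldHalfSpace_of_nonneg (by rw [coordReflection_apply_self]; linarith)]

lemma foldHalfSpace_apply_self_nonneg (x : EuclideanSpace ℝ (Fin n)) :
    0 ≤ foldHalfSpace k x k := by
  simp [foldHalfSpace]

lemma norm_foldHalfSpace (x : EuclideanSpace ℝ (Fin n)) : ‖foldHalfSpace k x‖ = ‖x‖ := by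
  rcases le_total 0 (x k) with h | h
  · rw [foldHalfSpace_of_nonneg h]
  · rw [foldHalfSpace_of_nonpos h, LinearIsometryEquiv.norm_map]

lemma lipschitzWith_foldHalfSpace (k : Fin n) : LipschitzWith 3 (foldHalfSpace k) := by
  refine LipschitzWith.of_dist_le_mul fun x y => ?_
  have h₁ : |x k - y k| ≤ ‖x - y‖ := by simpa using PiLp.norm_apply_le (x - y) k
  have h₂ : |(|x k| - |y k|)| ≤ |x k - y k| := abs_abs_sub_abs_le _ _
  have h₃ : foldHalfSpace k x - foldHalfSpace k y = (x - y) +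
      ((|x k| - |y k|) - (x k - y k)) • EuclideanSpace.single k 1 := by
    simp only [foldHalfSpace]
    module
  rw [dist_eq_norm, dist_eq_norm, h₃]
  refine (norm_add_le _ _).trans ?_
  have h₄ := abs_sub (|x k| - |y k|) (x k - y k)
  rw [norm_smul, PiLp.norm_single, norm_one, mul_one, Real.norm_eq_abs]
  norm_num
  linarith

lemma foldHalfSpace_mem_extRegion {x : EuclideanSpace ℝ (Fin n)} (hx : 1 < ‖x‖) :
    foldHalfSpace k x ∈ extRegion n k :=
  ⟨foldHalfSpace_apply_self_nonneg x, by rwa [norm_foldHalfSpace]⟩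

lemma locallyLipschitzOn_comp_foldHalfSpace (hu : ContDiffOn ℝ 2 u (extRegion n k)) :
    LocallyLipschitzOn {x | 1 < ‖x‖} fun x => u (foldHalfSpace k x) := by
  intro x hx
  have hlin : Convex ℝ {x : EuclideanSpace ℝ (Fin n) | 0 ≤ x k} :=
    convex_halfSpace_ge (EuclideanSpace.proj (𝕜 := ℝ) k).isLinear 0
  have hO : {y : EuclideanSpace ℝ (Fin n) | 1 < ‖y‖} ∈ 𝓝 (foldHalfSpace k x) :=
    (isOpen_lt continuous_const continuous_norm).mem_nhds (by simpa [norm_foldHalfSpace] using hx)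
  have hd : ContDiffWithinAt ℝ 1 u {x : EuclideanSpace ℝ (Fin n) | 0 ≤ x k}
      (foldHalfSpace k x) :=
    ((hu _ (foldHalfSpace_mem_extRegion hx)).of_le (by norm_num)).mono_of_mem_nhdsWithin
      (inter_mem_nhdsWithin _ hO)
  obtain ⟨K, t, ht, hK⟩ := hd.exists_lipschitzOnWith hlin
  have hF := lipschitzWith_foldHalfSpace k
  refine ⟨K * 3, foldHalfSpace k ⁻¹' t, ?_, hK.comp hF.lipschitzOnWith (mapsTo_preimage _ _)⟩
  refine mem_nhdsWithin_of_mem_nhds ?_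
  exact (tendsto_nhdsWithin_iff.2 ⟨hF.continuous.tendsto x,
    Eventually.of_forall fun y => foldHalfSpace_apply_self_nonneg y⟩) ht

lemma lapWithin_extRegion_eq_sum {x : EuclideanSpace ℝ (Fin n)} (hx : x ∈ extRegion n k)
    (b : OrthonormalBasis (Fin n) ℝ (EuclideanSpace ℝ (Fin n))) :
    ∑ i, iteratedFDerivWithin ℝ 2 u (extRegion n k) x ![b i, b i] =
      lapWithin n (extRegion n k) u x := by
  have hS := uniqueDiffOn_extRegion n k
  rw [← InnerProductSpace.laplacianWithin_eq_iteratedFDerivWithin_orthonormalBasis u hS hx b,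
    InnerProductSpace.laplacianWithin_eq_iteratedFDerivWithin_orthonormalBasis u hS hx
      (EuclideanSpace.basisFun (Fin n) ℝ)]
  simp [lapWithin]

/-- Even reflection across the boundary of the half-space preserves harmonicity under the Neumann
condition: points of the closed half-space. -/
lemma hasSymmLaplacianAt_comp_foldHalfSpace_of_mem (hu : ContDiffOn ℝ 2 u (extRegion n k))
    (hharm : ∀ x ∈ extRegion n k, lapWithin n (extRegion n k) u x = 0)
    (hneum : ∀ x ∈ extRegion n k, x k = 0 →
      fderivWithin ℝ u (extRegion n k) x (EuclideanSpace.single k 1) = 0)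
    {x : EuclideanSpace ℝ (Fin n)} (hx : x ∈ extRegion n k) :
    HasSymmLaplacianAt (fun y => u (foldHalfSpace k y)) 0 x := by
  have hS := uniqueDiffOn_extRegion n k
  have hnorm : ∀ v : EuclideanSpace ℝ (Fin n), ∀ᶠ t : ℝ in 𝓝[>] 0, 1 < ‖x + t • v‖ := by
    intro v
    have hcont : Continuous fun t : ℝ => ‖x + t • v‖ := by fun_prop
    exact (hcont.continuousAt.eventually
      (lt_mem_nhds (by simpa using hx.2))).filter_mono nhdsWithin_le_nhds
  have hwx : u (foldHalfSpace k x) = u x := by rw [foldHalfSpace_of_nonneg hx.1]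
  have hQneg : ∀ v, iteratedFDerivWithin ℝ 2 u (extRegion n k) x ![-v, -v] =
      iteratedFDerivWithin ℝ 2 u (extRegion n k) x ![v, v] := fun v => by
    simp [iteratedFDerivWithin_two_apply u hS hx]
  intro b
  rcases eq_or_lt_of_le hx.1 with h0 | hpos
  · have hR : coordReflection k x = x := by rw [coordReflection_eq, ← h0]; simp
    have hD : ∀ v, fderivWithin ℝ u (extRegion n k) x (coordReflection k v) =
        fderivWithin ℝ u (extRegion n k) x v := fun v => by
      rw [coordReflection_eq, map_sub, map_smul, hneum x hx h0.symm]
      simp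
    have key : ∀ v : EuclideanSpace ℝ (Fin n), 0 ≤ v k →
        Tendsto (fun t : ℝ => (u (foldHalfSpace k (x + t • v)) + u (foldHalfSpace k (x - t • v))
          - 2 * u (foldHalfSpace k x)) / t ^ 2) (𝓝[>] 0)
        (𝓝 ((iteratedFDerivWithin ℝ 2 u (extRegion n k) x ![v, v] +
          iteratedFDerivWithin ℝ 2 u (extRegion n k) x
            ![coordReflection k v, coordReflection k v]) / 2)) := by
      intro v hv
      rw [← hQneg (coordReflection k v)]
      refine tendsto_second_difference_of_rays (w := fun y => u (foldHalfSpace k y))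
        hS hu hx hwx ?_ ?_ (by rw [map_neg, hD, add_neg_cancel])
      · filter_upwards [self_mem_nhdsWithin, hnorm v] with t ht hn
        have hmem : 0 ≤ (x + t • v) k := by
          simp only [PiLp.add_apply, PiLp.smul_apply, smul_eq_mul, ← h0, zero_add]
          exact mul_nonneg (le_of_lt ht) hv
        exact ⟨⟨hmem, hn⟩, by rw [foldHalfSpace_of_nonneg hmem]⟩
      · filter_upwards [self_mem_nhdsWithin, hnorm (-coordReflection k v)] with t ht hn
        have hmem : (x - t • v) k ≤ 0 := by
          simp only [PiLp.sub_apply, PiLp.smul_apply, smul_eq_mul, ← h0, zero_sub]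
          linarith [mul_nonneg (le_of_lt ht) hv]
        have heq : foldHalfSpace k (x - t • v) = x + t • -coordReflection k v := by
          rw [foldHalfSpace_of_nonpos hmem, map_sub, map_smul, hR, smul_neg, sub_eq_add_neg]
        refine ⟨⟨?_, hn⟩, by rw [heq]⟩
        rw [← heq]
        exact foldHalfSpace_apply_self_nonneg _
    have key' : ∀ v : EuclideanSpace ℝ (Fin n),
        Tendsto (fun t : ℝ => (u (foldHalfSpace k (x + t • v)) + u (foldHalfSpace k (x - t • v))
          - 2 * u (foldHalfSpace k x)) / t ^ 2) (𝓝[>] 0)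
        (𝓝 ((iteratedFDerivWithin ℝ 2 u (extRegion n k) x ![v, v] +
          iteratedFDerivWithin ℝ 2 u (extRegion n k) x
            ![coordReflection k v, coordReflection k v]) / 2)) := by
      intro v
      rcases le_total 0 (v k) with hv | hv
      · exact key v hv
      · have h := key (-v) (by simpa using hv)
        rw [map_neg, hQneg, hQneg] at h
        refine h.congr fun t => ?_
        rw [smul_neg, sub_neg_eq_add, ← sub_eq_add_neg, add_comm (u _)]
    convert! tendsto_finsetSum Finset.univ fun i _ => key' (b i) using 1
    rw [← Finset.sum_div, Finset.sum_add_distrib, lapWithin_extRegion_eq_sum hx b]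
    have h := lapWithin_extRegion_eq_sum (u := u) hx (b.map (coordReflection k))
    simp only [OrthonormalBasis.map_apply] at h
    rw [h, hharm x hx]
    simp
  · have hev : ∀ v : EuclideanSpace ℝ (Fin n), ∀ᶠ t : ℝ in 𝓝[>] 0,
        x + t • v ∈ extRegion n k ∧ u (foldHalfSpace k (x + t • v)) = u (x + t • v) := by
      intro v
      have hcont : Continuous fun t : ℝ => (x + t • v) k := by fun_prop
      have h : ∀ᶠ t : ℝ in 𝓝[>] 0, 0 < (x + t • v) k := (hcont.continuousAt.eventually
        (lt_mem_nhds (by simpa using hpos))).filter_mono nhdsWithin_le_nhds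
      filter_upwards [h, hnorm v] with t ht hn
      exact ⟨⟨ht.le, hn⟩, by rw [foldHalfSpace_of_nonneg ht.le]⟩
    have key : ∀ v : EuclideanSpace ℝ (Fin n),
        Tendsto (fun t : ℝ => (u (foldHalfSpace k (x + t • v)) + u (foldHalfSpace k (x - t • v))
          - 2 * u (foldHalfSpace k x)) / t ^ 2) (𝓝[>] 0)
        (𝓝 (iteratedFDerivWithin ℝ 2 u (extRegion n k) x ![v, v])) := by
      intro v
      have h := tendsto_second_difference_of_rays (w := fun y => u (foldHalfSpace k y))
        hS hu hx hwx (hev v) (v₂ := -v)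
        ((hev (-v)).mono fun t ht => ⟨ht.1, by
          rw [← ht.2, smul_neg, ← sub_eq_add_neg]⟩) (by rw [map_neg, add_neg_cancel])
      rwa [hQneg, add_self_div_two] at h
    convert! tendsto_finsetSum Finset.univ fun i _ => key (b i) using 1
    rw [lapWithin_extRegion_eq_sum hx b, hharm x hx]

/-- Even reflection across the boundary of the half-space preserves harmonicity under the Neumann
condition. -/
lemma hasSymmLaplacianAt_comp_foldHalfSpace (hu : ContDiffOn ℝ 2 u (extRegion n k))
    (hharm : ∀ x ∈ extRegion n k, lapWithin n (extRegion n k) u x = 0)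
    (hneum : ∀ x ∈ extRegion n k, x k = 0 →
      fderivWithin ℝ u (extRegion n k) x (EuclideanSpace.single k 1) = 0)
    {x : EuclideanSpace ℝ (Fin n)} (hx : 1 < ‖x‖) :
    HasSymmLaplacianAt (fun y => u (foldHalfSpace k y)) 0 x := by
  rcases le_total 0 (x k) with h | h
  · exact hasSymmLaplacianAt_comp_foldHalfSpace_of_mem hu hharm hneum ⟨h, hx⟩
  · have hmem : coordReflection k x ∈ extRegion n k :=
      ⟨by rw [coordReflection_apply_self]; linarith, by rwa [LinearIsometryEquiv.norm_map]⟩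
    simpa only [foldHalfSpace_coordReflection] using
      (hasSymmLaplacianAt_comp_foldHalfSpace_of_mem hu hharm hneum hmem).comp_isometry
        (coordReflection k)

end HalfSpace

/-- a function `u`, `C²` on `E = {x ∈ ℝⁿ₊ : |x| > 1}`, harmonic on `E`,
satisfying the Neumann condition `∂u/∂xₙ = 0` on `{x ∈ E : xₙ = 0}` and `u → 1` at
infinity, admits the expansion `u(x) = 1 + C|x|^{2-n} + O(|x|^{1-n})`. -/
theorem stmt_10 (n : ℕ) (hn : 3 ≤ n)
    (u : EuclideanSpace ℝ (Fin n) → ℝ)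
    (hu : ContDiffOn ℝ 2 u (extRegion n ⟨n - 1, by omega⟩))
    (hharm : ∀ x ∈ extRegion n ⟨n - 1, by omega⟩,
      lapWithin n (extRegion n ⟨n - 1, by omega⟩) u x = 0)
    (hneum : ∀ x ∈ extRegion n ⟨n - 1, by omega⟩, x ⟨n - 1, by omega⟩ = 0 →
      fderivWithin ℝ u (extRegion n ⟨n - 1, by omega⟩) x
        (EuclideanSpace.single ⟨n - 1, by omega⟩ 1) = 0)
    (hlim : ∀ ε : ℝ, 0 < ε → ∃ R : ℝ,
      ∀ x ∈ extRegion n ⟨n - 1, by omega⟩, R ≤ ‖x‖ → |u x - 1| < ε) :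
    ∃ C A R₀ : ℝ, 0 < A ∧ 1 < R₀ ∧
      ∀ x ∈ extRegion n ⟨n - 1, by omega⟩, R₀ ≤ ‖x‖ →
        |u x - 1 - C * ‖x‖ ^ ((2 : ℝ) - n)| ≤ A * ‖x‖ ^ ((1 : ℝ) - n) := by
  have hLip : LocallyLipschitzOn {x | 1 < ‖x‖}
      fun x => u (foldHalfSpace ⟨n - 1, by omega⟩ x) - 1 := fun x hx => by
    obtain ⟨K, t, ht, hK⟩ := locallyLipschitzOn_comp_foldHalfSpace hu hx
    exact ⟨K, t, ht, fun y hy z hz => by simpa [edist_sub_right] using hK hy hz⟩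
  obtain ⟨C, A, hA, h⟩ := exists_exterior_expansion hn hLip
    (fun x hx => (hasSymmLaplacianAt_comp_foldHalfSpace hu hharm hneum hx).sub_const 1)
    (fun ε hε => by
      obtain ⟨R, hR⟩ := hlim ε hε
      refine ⟨max R 2, fun x hx => ?_⟩
      obtain ⟨h₁, h₂⟩ := max_le_iff.1 hx
      exact hR _ (foldHalfSpace_mem_extRegion (by linarith)) (by rwa [norm_foldHalfSpace]))
  refine ⟨C, A, 2, hA, one_lt_two, fun x hx hx2 => ?_⟩
  simpa only [foldHalfSpace_of_nonneg hx.1] using h x hx2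
end
end
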